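/- arXiv:1603.02926 — 4 statements merged into one kernel-verified Lean document; each statement's English description precedes it below -/
import Mathlib

section
/- Let Ω be a body in ℝ^m and let k : (0,∞) → ℝ satisfy condition (C¹_α) for some α > 1. Then the potential K_Ω is continuously differentiable on ℝ^m and, for each j, ∂K_Ω/∂x_j(x) = ∫_Ω (∂/∂x_j) k(|x−y|) dy for every x ∈ ℝ^m (the integrand being defined for almost every y ∈ Ω). -/
open Set MeasureTheory Filter Asymptotics Metric
open scoped Topology RealInnerProductSpace

noncomputable section

/-- `m`-dimensional Euclidean space. -/
abbrev Euc (m : ℕ) := EuclideanSpace ℝ (Fin m)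

/-- A body: the closure of a nonempty bounded open set. -/
def IsBody {m : ℕ} (Ω : Set (Euc m)) : Prop :=
  ∃ U : Set (Euc m), IsOpen U ∧ U.Nonempty ∧ Bornology.IsBounded U ∧ Ω = closure U

/-- The potential `K_Ω(x) = ∫_Ω k(|x - y|) dy`. -/
def pot {m : ℕ} (k : ℝ → ℝ) (Ω : Set (Euc m)) (x : Euc m) : ℝ :=
  ∫ y in Ω, k (dist x y)

/-- Condition `(C⁰_α)`. -/
def CondC0 (m : ℕ) (α : ℝ) (k : ℝ → ℝ) : Prop :=
  ContinuousOn k (Ioi 0) ∧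
  (α < m → k =O[𝓝[>] (0:ℝ)] fun r : ℝ => r ^ (α - m)) ∧
  (α = m → k =O[𝓝[>] (0:ℝ)] fun r : ℝ => Real.log r) ∧
  ((m : ℝ) < α → k =O[𝓝[>] (0:ℝ)] fun _ : ℝ => (1:ℝ))

/-- Condition `(C¹_α)`. -/
def CondC1 (m : ℕ) (α : ℝ) (k : ℝ → ℝ) : Prop :=
  ContDiffOn ℝ 1 k (Ioi 0) ∧
  (α < m → k =O[𝓝[>] (0:ℝ)] fun r : ℝ => r ^ (α - m)) ∧
  (α = m → k =O[𝓝[>] (0:ℝ)] fun r : ℝ => Real.log r) ∧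
  ((m : ℝ) < α → k =O[𝓝[>] (0:ℝ)] fun _ : ℝ => (1:ℝ)) ∧
  (α < m + 1 → deriv k =O[𝓝[>] (0:ℝ)] fun r : ℝ => r ^ (α - m - 1)) ∧
  (α = m + 1 → deriv k =O[𝓝[>] (0:ℝ)] fun r : ℝ => Real.log r) ∧
  ((m : ℝ) + 1 < α → deriv k =O[𝓝[>] (0:ℝ)] fun _ : ℝ => (1:ℝ))

/-- Reflection of `ℝ^m` in the hyperplane `{z : z ⬝ v = b}` (for a unit vector `v`). -/
def reflAt {m : ℕ} (v : Euc m) (b : ℝ) (z : Euc m) : Euc m :=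
  z + (2 * (b - ⟪z, v⟫)) • v

/-- `Ω⁺_{v,b}`, the part of `Ω` of height at least `b` in direction `v`. -/
def upSet {m : ℕ} (Ω : Set (Euc m)) (v : Euc m) (b : ℝ) : Set (Euc m) :=
  {z ∈ Ω | b ≤ ⟪z, v⟫}

/-- The minimum folding height `l(v)`. -/
def foldHeight {m : ℕ} (Ω : Set (Euc m)) (v : Euc m) : ℝ :=
  sInf {a : ℝ | ∀ b ≥ a, reflAt v b '' upSet Ω v b ⊆ Ω}

/-- The minimal unfolded region `Uf(Ω)`. -/
def unfolded {m : ℕ} (Ω : Set (Euc m)) : Set (Euc m) :=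
  ⋂ v ∈ sphere (0 : Euc m) 1, {z : Euc m | ⟪z, v⟫ ≤ foldHeight Ω v}

/-- `Ω` is convex in the direction `v`: every line parallel to `v` meets `Ω` in a connected set. -/
def ConvexInDir {m : ℕ} (Ω : Set (Euc m)) (v : Euc m) : Prop :=
  ∀ z : Euc m, ⟪z, v⟫ = 0 → IsPreconnected (Ω ∩ {w : Euc m | ∃ t : ℝ, w = z + t • v})

/-- `d(Ω) = min {|z - w| : z ∈ Uf(Ω), w ∈ ∂Ω}`. -/
def dMin {m : ℕ} (Ω : Set (Euc m)) : ℝ :=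
  sInf {d : ℝ | ∃ z ∈ unfolded Ω, ∃ w ∈ frontier Ω, d = dist z w}

/-- `D(Ω) = max {|z - w| : z ∈ Uf(Ω), w ∈ ∂Ω}`. -/
def dMax {m : ℕ} (Ω : Set (Euc m)) : ℝ :=
  sSup {d : ℝ | ∃ z ∈ unfolded Ω, ∃ w ∈ frontier Ω, d = dist z w}

/-- The `r^{α-m}`-potential `V^{(α)}_Ω`. -/
def rpot (m : ℕ) (α : ℝ) (Ω : Set (Euc m)) (x : Euc m) : ℝ :=
  if α = (m : ℝ) then -∫ y in Ω, Real.log (dist x y)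
  else Real.sign ((m : ℝ) - α) * ∫ y in Ω, dist x y ^ (α - (m : ℝ))

/-- The solid-angle (Poisson) potential `A_Ω(x, h)`. -/
def apot (m : ℕ) (Ω : Set (Euc m)) (x : Euc m) (h : ℝ) : ℝ :=
  ∫ y in Ω, h / (dist x y ^ 2 + h ^ 2) ^ (((m : ℝ) + 1) / 2)

theorem exists_le_rpow_of_isBigO {h : ℝ → ℝ} {β : ℝ} (hc : ContinuousOn h (Ioi 0))
    (hO : h =O[𝓝[>] (0 : ℝ)] fun r : ℝ => r ^ (-β)) (R : ℝ) :
    ∃ C, 0 ≤ C ∧ ∀ r ∈ Ioc 0 R, |h r| ≤ C * r ^ (-β) := by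
  obtain ⟨C₀, hC₀, hb⟩ := hO.exists_pos
  rw [IsBigOWith] at hb
  obtain ⟨δ, hδ, hsub⟩ := mem_nhdsGT_iff_exists_Ioo_subset.1 hb
  have hδ : 0 < δ := hδ
  have hcont : ContinuousOn (fun r : ℝ => h r * r ^ β) (Icc δ R) := by
    have hpos : Icc δ R ⊆ Ioi 0 := fun r hr => lt_of_lt_of_le hδ hr.1
    exact (hc.mono hpos).mul
      (continuousOn_id.rpow_const fun r hr => Or.inl (ne_of_gt (hpos hr)))
  obtain ⟨C₁, hC₁⟩ := isCompact_Icc.exists_bound_of_continuousOn hcont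
  refine ⟨max C₀ C₁, le_max_of_le_left hC₀.le, fun r hr => ?_⟩
  have hrpos : 0 < r ^ (-β) := Real.rpow_pos_of_pos hr.1 _
  rcases lt_or_ge r δ with h1 | h1
  · have := hsub ⟨hr.1, h1⟩
    simp only [mem_ofPred_eq, Real.norm_eq_abs, abs_of_pos hrpos] at this
    exact this.trans (by gcongr; exact le_max_left _ _)
  · have := hC₁ r ⟨h1, hr.2⟩
    rw [Real.norm_eq_abs, abs_mul, abs_of_pos (Real.rpow_pos_of_pos hr.1 β)] at this
    rw [Real.rpow_neg hr.1.le, ← div_eq_mul_inv, le_div_iff₀ (Real.rpow_pos_of_pos hr.1 β)]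
    exact this.trans (le_max_right _ _)

theorem isBigO_rpow_rpow_nhdsGT_zero {a b : ℝ} (hab : b ≤ a) :
    (fun r : ℝ => r ^ a) =O[𝓝[>] (0 : ℝ)] fun r : ℝ => r ^ b := by
  refine IsBigO.of_bound 1 ?_
  filter_upwards [Ioo_mem_nhdsGT (zero_lt_one' ℝ)] with r hr
  rw [Real.norm_of_nonneg (Real.rpow_nonneg hr.1.le _),
    Real.norm_of_nonneg (Real.rpow_nonneg hr.1.le _), one_mul]
  exact Real.rpow_le_rpow_of_exponent_ge hr.1 hr.2.le hab

theorem isBigO_rpow_of_trichotomy {h : ℝ → ℝ} {γ α : ℝ} {b : ℝ} (hb : b < 0) (hbα : b ≤ α - γ)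
    (h1 : α < γ → h =O[𝓝[>] (0 : ℝ)] fun r : ℝ => r ^ (α - γ))
    (h2 : α = γ → h =O[𝓝[>] (0 : ℝ)] fun r : ℝ => Real.log r)
    (h3 : γ < α → h =O[𝓝[>] (0 : ℝ)] fun _ : ℝ => (1 : ℝ)) :
    h =O[𝓝[>] (0 : ℝ)] fun r : ℝ => r ^ b := by
  rcases lt_trichotomy α γ with hα | hα | hα
  · exact (h1 hα).trans (isBigO_rpow_rpow_nhdsGT_zero hbα)
  · exact (h2 hα).trans (isLittleO_log_rpow_nhdsGT_zero hb).isBigO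
  · have := isBigO_rpow_rpow_nhdsGT_zero hb.le
    simp only [Real.rpow_zero] at this
    exact (h3 hα).trans this

/-- Under `(C¹_α)` with `α > 1`, both `k` and `k'` are `O(r ^ (-β))` on bounded intervals for some
locally integrable exponent `β < m`. -/
theorem CondC1.exists_rpow_bound {m : ℕ} (hm : 1 ≤ m) {α : ℝ} (hα : 1 < α) {k : ℝ → ℝ}
    (hk : CondC1 m α k) :
    ∃ β : ℝ, 0 ≤ β ∧ β < m ∧ ∀ R : ℝ, ∃ C, 0 ≤ C ∧
      ∀ r ∈ Ioc 0 R, |k r| ≤ C * r ^ (-β) ∧ |deriv k r| ≤ C * r ^ (-β) := by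
  obtain ⟨hk0, hk1, hk2, hk3, hd1, hd2, hd3⟩ := hk
  have hm' : (1 : ℝ) ≤ m := by exact_mod_cast hm
  set β : ℝ := max (m + 1 - α) (1 / 2) with hβ
  have hβpos : (0 : ℝ) < β := lt_max_of_lt_right (by norm_num)
  have hβα : m + 1 - α ≤ β := le_max_left _ _
  refine ⟨β, hβpos.le, max_lt (by linarith) (by linarith), fun R => ?_⟩
  have hkO := isBigO_rpow_of_trichotomy (b := -β) (by linarith) (by linarith) hk1 hk2 hk3
  have hdO := isBigO_rpow_of_trichotomy (γ := (m : ℝ) + 1) (b := -β) (by linarith) (by linarith)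
    (by simpa only [sub_sub] using hd1) hd2 hd3
  have hdc : ContinuousOn (deriv k) (Ioi 0) := hk0.continuousOn_deriv_of_isOpen isOpen_Ioi le_rfl
  obtain ⟨C, hC, hCk⟩ := exists_le_rpow_of_isBigO hk0.continuousOn hkO R
  obtain ⟨D, hD, hDk⟩ := exists_le_rpow_of_isBigO hdc hdO R
  refine ⟨max C D, le_max_of_le_left hC, fun r hr => ⟨(hCk r hr).trans ?_, (hDk r hr).trans ?_⟩⟩
  · exact mul_le_mul_of_nonneg_right (le_max_left _ _) (Real.rpow_nonneg hr.1.le _)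
  · exact mul_le_mul_of_nonneg_right (le_max_right _ _) (Real.rpow_nonneg hr.1.le _)

section Convolution

variable {E F : Type*} [NormedAddCommGroup E] [NormedSpace ℝ E] [FiniteDimensional ℝ E]
  [MeasurableSpace E] [BorelSpace E] [NormedAddCommGroup F]
  {μ : Measure E} [μ.IsAddHaarMeasure]

theorem integrableOn_comp_sub_left {h : E → F} (hh : LocallyIntegrable h μ) {Ω : Set E}
    (hΩ : Bornology.IsBounded Ω) (x : E) : IntegrableOn (fun y => h (x - y)) Ω μ := by
  obtain ⟨R, hR⟩ := hΩ.subset_closedBall 0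
  have h1 : IntegrableOn h (closedBall 0 (‖x‖ + R)) μ :=
    hh.integrableOn_isCompact (isCompact_closedBall _ _)
  have h2 := ((Measure.measurePreserving_sub_left μ x).integrableOn_comp_preimage
    (Homeomorph.subLeft x).measurableEmbedding).2 h1
  refine h2.mono_set fun y hy => ?_
  have := hR hy
  simp only [mem_preimage, mem_closedBall, dist_zero_right] at this ⊢
  exact (norm_sub_le _ _).trans (by gcongr)

variable [NormedSpace ℝ F]

theorem tendstoUniformlyOn_integral_comp_sub_left {h : E → F} {hn : ℕ → E → F}
    (hh : LocallyIntegrable h μ) (hhn : ∀ n, LocallyIntegrable (hn n) μ)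
    (hlim : ∀ R, Tendsto (fun n => ∫ z in closedBall 0 R, ‖hn n z - h z‖ ∂μ) atTop (𝓝 0))
    {Ω : Set E} (hΩ : Bornology.IsBounded Ω) (r : ℝ) :
    TendstoUniformlyOn (fun n x => ∫ y in Ω, hn n (x - y) ∂μ) (fun x => ∫ y in Ω, h (x - y) ∂μ)
      atTop (ball 0 r) := by
  obtain ⟨R, hR⟩ := hΩ.subset_closedBall 0
  rw [Metric.tendstoUniformlyOn_iff]
  intro ε hε
  filter_upwards [(hlim (r + R)).eventually_lt_const hε] with n hlt x hx
  refine lt_of_le_of_lt ?_ hlt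
  have hx : ‖x‖ < r := by simpa using hx
  have hd : LocallyIntegrable (fun z => ‖hn n z - h z‖) μ := fun z => ((hhn n).sub hh z).norm
  rw [dist_eq_norm', ← integral_sub (integrableOn_comp_sub_left (hhn n) hΩ x)
    (integrableOn_comp_sub_left hh hΩ x)]
  refine (norm_integral_le_integral_norm _).trans ?_
  have hemb := (Homeomorph.subLeft x).measurableEmbedding
  have hmp := Measure.measurePreserving_sub_left μ x
  refine le_trans ?_ (hmp.setIntegral_preimage_emb hemb
    (fun z => ‖hn n z - h z‖) (closedBall 0 (r + R))).le
  refine setIntegral_mono_set ?_ (ae_of_all _ fun _ => norm_nonneg _) ?_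
  · exact (hmp.integrableOn_comp_preimage hemb).2
      (hd.integrableOn_isCompact (isCompact_closedBall _ _))
  · refine LE.le.eventuallyLE fun y hy => ?_
    have := hR hy
    simp only [mem_preimage, mem_closedBall, dist_zero_right] at this ⊢
    exact (norm_sub_le _ _).trans (by gcongr)

theorem hasFDerivAt_integral_comp_sub_left {f : E → F} (hf : ContDiff ℝ 1 f) {Ω : Set E}
    (hΩ : IsCompact Ω) (x : E) :
    HasFDerivAt (fun x => ∫ y in Ω, f (x - y) ∂μ) (∫ y in Ω, fderiv ℝ f (x - y) ∂μ) x := by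
  have hf' : Continuous (fderiv ℝ f) := hf.continuous_fderiv one_ne_zero
  have hK : IsCompact (closedBall x 1 ×ˢ Ω) := (isCompact_closedBall x 1).prod hΩ
  obtain ⟨C, hC⟩ := hK.exists_bound_of_continuousOn
    (f := fun p : E × E => fderiv ℝ f (p.1 - p.2)) (by fun_prop)
  refine hasFDerivAt_integral_of_dominated_of_fderiv_le (bound := fun _ => C)
    (F' := fun x y => fderiv ℝ f (x - y)) (closedBall_mem_nhds x one_pos) ?_ ?_ ?_ ?_ ?_ ?_
  · exact Eventually.of_forall fun z =>
      (hf.continuous.comp (continuous_const.sub continuous_id)).aestronglyMeasurable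
  · exact integrableOn_comp_sub_left hf.continuous.locallyIntegrable hΩ.isBounded x
  · exact (hf'.comp (continuous_const.sub continuous_id)).aestronglyMeasurable
  · exact (ae_restrict_iff' hΩ.measurableSet).2
      (ae_of_all _ fun y hy z hz => hC (z, y) ⟨hz, hy⟩)
  · exact integrableOn_const hΩ.measure_lt_top.ne
  · refine ae_of_all _ fun y z _ => ?_
    have := (hf.differentiable one_ne_zero (z - y)).hasFDerivAt
    exact (hasFDerivAt_comp_sub y).2 this

/-- If `C¹` functions `f n` converge to `κ` in `L¹_loc` and their derivatives converge to `g` in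
`L¹_loc`, then `x ↦ ∫ y in Ω, κ (x - y)` is `C¹` with derivative `x ↦ ∫ y in Ω, g (x - y)`. -/
theorem hasFDerivAt_integral_comp_sub_left_of_tendsto {κ : E → F} {g : E → E →L[ℝ] F}
    {f : ℕ → E → F} (hf : ∀ n, ContDiff ℝ 1 (f n)) (hκ : LocallyIntegrable κ μ)
    (hg : LocallyIntegrable g μ)
    (hfκ : ∀ R, Tendsto (fun n => ∫ z in closedBall 0 R, ‖f n z - κ z‖ ∂μ) atTop (𝓝 0))
    (hfg : ∀ R, Tendsto (fun n => ∫ z in closedBall 0 R, ‖fderiv ℝ (f n) z - g z‖ ∂μ)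
      atTop (𝓝 0))
    {Ω : Set E} (hΩ : IsCompact Ω) :
    (Continuous fun x => ∫ y in Ω, g (x - y) ∂μ) ∧
      ∀ x, HasFDerivAt (fun x => ∫ y in Ω, κ (x - y) ∂μ) (∫ y in Ω, g (x - y) ∂μ) x := by
  have hf' : ∀ n, Continuous (fderiv ℝ (f n)) := fun n => (hf n).continuous_fderiv one_ne_zero
  have hu := tendstoUniformlyOn_integral_comp_sub_left hκ
    (fun n => (hf n).continuous.locallyIntegrable) hfκ hΩ.isBounded
  have hu' := tendstoUniformlyOn_integral_comp_sub_left hg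
    (fun n => (hf' n).locallyIntegrable) hfg hΩ.isBounded
  have hmem : ∀ x : E, x ∈ ball (0 : E) (‖x‖ + 1) := fun x => by simp
  constructor
  · refine continuous_iff_continuousAt.2 fun x => ?_
    refine ((hu' (‖x‖ + 1)).continuousOn (Frequently.of_forall fun n => ?_)).continuousAt
      (isOpen_ball.mem_nhds (hmem x))
    refine (continuous_parametric_integral_of_continuous (μ := μ)
      (f := fun x y => fderiv ℝ (f n) (x - y)) ?_ hΩ).continuousOn
    exact (hf' n).comp (continuous_fst.sub continuous_snd)
  · intro x
    exact hasFDerivAt_of_tendstoUniformlyOn (g' := fun x => ∫ y in Ω, g (x - y) ∂μ)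
      isOpen_ball (hu' (‖x‖ + 1))
      (fun n z _ => hasFDerivAt_integral_comp_sub_left (hf n) hΩ z)
      (fun z hz => (hu (‖x‖ + 1)).tendsto_at hz) (hmem x)

end Convolution

section Radial

variable {E : Type*} [NormedAddCommGroup E] [InnerProductSpace ℝ E]

/-- The candidate gradient of `z ↦ k √(‖z‖² + ε²)`. -/
def radialFDeriv (k : ℝ → ℝ) (ε : ℝ) (z : E) : E →L[ℝ] ℝ :=
  (deriv k √(‖z‖ ^ 2 + ε ^ 2) * (√(‖z‖ ^ 2 + ε ^ 2))⁻¹) • innerSL ℝ z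

theorem hasFDerivAt_radial {k : ℝ → ℝ} (hk : DifferentiableOn ℝ k (Ioi 0)) {ε : ℝ} {z : E}
    (hz : 0 < ‖z‖ ^ 2 + ε ^ 2) :
    HasFDerivAt (fun z : E => k √(‖z‖ ^ 2 + ε ^ 2)) (radialFDeriv k ε z) z := by
  have hρ : 0 < √(‖z‖ ^ 2 + ε ^ 2) := Real.sqrt_pos.2 hz
  have h1 : HasFDerivAt (fun z : E => ‖z‖ ^ 2 + ε ^ 2) (2 • innerSL ℝ z) z :=
    (hasStrictFDerivAt_norm_sq z).hasFDerivAt.add_const _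
  have h2 := h1.sqrt hz.ne'
  have h3 := (hk.differentiableAt (Ioi_mem_nhds hρ)).hasDerivAt.comp_hasFDerivAt z h2
  refine h3.congr_fderiv ?_
  ext v
  simp [radialFDeriv]
  field_simp

theorem norm_radialFDeriv_le (k : ℝ → ℝ) (ε : ℝ) (z : E) :
    ‖radialFDeriv k ε z‖ ≤ |deriv k √(‖z‖ ^ 2 + ε ^ 2)| := by
  have hle : ‖z‖ ≤ √(‖z‖ ^ 2 + ε ^ 2) := Real.le_sqrt_of_sq_le (by nlinarith [sq_nonneg ε])
  rw [radialFDeriv, norm_smul, innerSL_apply_norm, norm_mul, norm_inv, Real.norm_eq_abs,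
    Real.norm_eq_abs, abs_of_nonneg (Real.sqrt_nonneg _), mul_assoc]
  refine mul_le_of_le_one_right (abs_nonneg _) ?_
  rw [inv_mul_eq_div]
  exact div_le_one_of_le₀ hle (Real.sqrt_nonneg _)

theorem continuousAt_radialFDeriv {k : ℝ → ℝ} (hk : ContinuousOn (deriv k) (Ioi 0)) {X : Type*}
    [TopologicalSpace X] {e : X → ℝ} {z : X → E} {x : X} (he : ContinuousAt e x)
    (hz : ContinuousAt z x) (hpos : 0 < ‖z x‖ ^ 2 + e x ^ 2) :
    ContinuousAt (fun x => radialFDeriv k (e x) (z x)) x := by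
  have hρ : 0 < √(‖z x‖ ^ 2 + e x ^ 2) := Real.sqrt_pos.2 hpos
  have hc : ContinuousAt (fun x => √(‖z x‖ ^ 2 + e x ^ 2)) x := by fun_prop
  have hd : ContinuousAt (fun x => deriv k √(‖z x‖ ^ 2 + e x ^ 2)) x :=
    ContinuousAt.comp' (hk.continuousAt (Ioi_mem_nhds hρ)) hc
  exact (hd.mul (hc.inv₀ hρ.ne')).smul ((innerSL ℝ).continuous.continuousAt.comp' hz)

theorem contDiff_radial {k : ℝ → ℝ} (hk : ContDiffOn ℝ 1 k (Ioi 0)) {ε : ℝ} (hε : 0 < ε) :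
    ContDiff ℝ 1 fun z : E => k √(‖z‖ ^ 2 + ε ^ 2) := by
  have hpos : ∀ z : E, 0 < ‖z‖ ^ 2 + ε ^ 2 := fun z => by positivity
  have h1 : ContDiff ℝ 1 fun z : E => √(‖z‖ ^ 2 + ε ^ 2) :=
    ((contDiff_norm_sq ℝ).add contDiff_const).sqrt fun z => (hpos z).ne'
  exact hk.comp_contDiff h1 fun z => Real.sqrt_pos.2 (hpos z)

end Radial

section L1

variable {E F : Type*} [NormedAddCommGroup E] [NormedSpace ℝ E] [FiniteDimensional ℝ E]
  [MeasurableSpace E] [BorelSpace E] [NormedAddCommGroup F]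
  {μ : Measure E} [μ.IsAddHaarMeasure]

/-- Dominated convergence in `L¹_loc` with a locally integrable power of the norm as majorant. -/
theorem locallyIntegrable_and_tendsto_of_le_rpow {h : E → F} {hn : ℕ → E → F} {β : ℝ}
    (hd : 1 ≤ Module.finrank ℝ E) (hβ : β < Module.finrank ℝ E)
    (hcont : ∀ n, Continuous (hn n))
    (hlim : ∀ z, z ≠ 0 → Tendsto (fun n => hn n z) atTop (𝓝 (h z)))
    (hbound : ∀ R, ∃ C, ∀ n z, z ≠ 0 → ‖z‖ ≤ R → ‖hn n z‖ ≤ C * ‖z‖ ^ (-β)) :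
    LocallyIntegrable h μ ∧
      ∀ R, Tendsto (fun n => ∫ z in closedBall 0 R, ‖hn n z - h z‖ ∂μ) atTop (𝓝 0) := by
  have : Nontrivial E := Module.nontrivial_of_finrank_pos (R := ℝ) hd
  have hne : ∀ᵐ z ∂μ, z ≠ 0 := Measure.ae_ne μ 0
  have hmeas : AEStronglyMeasurable h μ :=
    aestronglyMeasurable_of_tendsto_ae atTop (fun n => (hcont n).aestronglyMeasurable)
      (hne.mono hlim)
  have hlimbound : ∀ {R C : ℝ}, (∀ n z, z ≠ 0 → ‖z‖ ≤ R → ‖hn n z‖ ≤ C * ‖z‖ ^ (-β)) →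
      ∀ z, z ≠ 0 → ‖z‖ ≤ R → ‖h z‖ ≤ C * ‖z‖ ^ (-β) := fun hC z hz hzR =>
    le_of_tendsto (hlim z hz).norm (Eventually.of_forall fun n => hC n z hz hzR)
  constructor
  · rw [locallyIntegrable_iff]
    intro K hK
    obtain ⟨R, _, hR⟩ := hK.isBounded.exists_pos_norm_lt
    obtain ⟨C, hC⟩ := hbound R
    refine (integrableOn_ball_of_norm_le_rpow (r := R) (C := C) hd hβ ?_ hmeas).mono_set
      fun z hz => mem_ball_zero_iff.2 (hR z hz)
    rw [ae_restrict_iff' measurableSet_ball]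
    filter_upwards [hne] with z hz hzR
    exact hlimbound hC z hz (mem_ball_zero_iff.1 hzR).le
  · intro R
    obtain ⟨C, hC⟩ := hbound R
    have hpow : LocallyIntegrable (fun z : E => ‖z‖ ^ (-β)) μ :=
      locallyIntegrable_of_norm_le_rpow (C := 1) hd hβ
        (ae_of_all _ fun z => by
          rw [one_mul, Real.norm_of_nonneg (Real.rpow_nonneg (norm_nonneg _) _)])
        (measurable_norm.pow_const _).aestronglyMeasurable
    rw [← integral_zero E ℝ (μ := μ.restrict (closedBall 0 R))]
    refine tendsto_integral_of_dominated_convergence (fun z => 2 * C * ‖z‖ ^ (-β)) ?_ ?_ ?_ ?_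
    · exact fun n => ((hcont n).aestronglyMeasurable.sub hmeas).norm.restrict
    · exact (hpow.integrableOn_isCompact (isCompact_closedBall _ _)).const_mul _
    · intro n
      rw [ae_restrict_iff' measurableSet_closedBall]
      filter_upwards [hne] with z hz hzR
      rw [mem_closedBall_zero_iff] at hzR
      rw [norm_norm]
      refine (norm_sub_le _ _).trans ?_
      linarith [hC n z hz hzR, hlimbound hC z hz hzR]
    · refine ae_restrict_of_ae (hne.mono fun z hz => ?_)
      simpa using ((hlim z hz).sub_const (h z)).norm

end L1

theorem IsBody.isCompact {m : ℕ} {Ω : Set (Euc m)} (hΩ : IsBody Ω) : IsCompact Ω := by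
  obtain ⟨U, -, -, hU, rfl⟩ := hΩ
  exact hU.isCompact_closure

theorem CondC1.hasFDerivAt_pot {m : ℕ} (hm : 1 ≤ m) {α : ℝ} (hα : 1 < α) {k : ℝ → ℝ}
    (hk : CondC1 m α k) {Ω : Set (Euc m)} (hΩ : IsCompact Ω) :
    LocallyIntegrable (fun z : Euc m => fderiv ℝ (fun z : Euc m => k ‖z‖) z) volume ∧
    (Continuous fun x => ∫ y in Ω, fderiv ℝ (fun z : Euc m => k ‖z‖) (x - y)) ∧
      ∀ x, HasFDerivAt (pot k Ω) (∫ y in Ω, fderiv ℝ (fun z : Euc m => k ‖z‖) (x - y)) x := by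
  obtain ⟨β, hβ0, hβm, hβ⟩ := hk.exists_rpow_bound hm hα
  have hk1 : ContDiffOn ℝ 1 k (Ioi 0) := hk.1
  have hkd : DifferentiableOn ℝ k (Ioi 0) := hk1.differentiableOn one_ne_zero
  have hdc : ContinuousOn (deriv k) (Ioi 0) := hk1.continuousOn_deriv_of_isOpen isOpen_Ioi le_rfl
  set ε : ℕ → ℝ := fun n => 1 / ((n : ℝ) + 1) with hε
  have hεpos : ∀ n, 0 < ε n := fun n => Nat.one_div_pos_of_nat
  have hε1 : ∀ n, ε n ≤ 1 := fun n => by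
    rw [hε]
    exact div_le_one_of_le₀ (by linarith [n.cast_nonneg (α := ℝ)]) (by positivity)
  have hεlim : Tendsto ε atTop (𝓝 0) := tendsto_one_div_add_atTop_nhds_zero_nat
  set f : ℕ → Euc m → ℝ := fun n z => k √(‖z‖ ^ 2 + ε n ^ 2) with hf
  have hfC : ∀ n, ContDiff ℝ 1 (f n) := fun n => contDiff_radial hk1 (hεpos n)
  have hfd : ∀ n z, fderiv ℝ (f n) z = radialFDeriv k (ε n) z := fun n z =>
    (hasFDerivAt_radial hkd (by have := hεpos n; positivity)).fderiv
  have hgd : ∀ z : Euc m, z ≠ 0 →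
      fderiv ℝ (fun z : Euc m => k ‖z‖) z = radialFDeriv k 0 z := fun z hz => by
    have := (hasFDerivAt_radial hkd (ε := 0) (z := z) (by positivity)).fderiv
    simpa using this
  have hbound : ∀ R, ∃ C, ∀ n (z : Euc m), z ≠ 0 → ‖z‖ ≤ R →
      |k √(‖z‖ ^ 2 + ε n ^ 2)| ≤ C * ‖z‖ ^ (-β) ∧
      |deriv k √(‖z‖ ^ 2 + ε n ^ 2)| ≤ C * ‖z‖ ^ (-β) := by
    intro R
    obtain ⟨C, hC0, hC⟩ := hβ (R + 1)
    refine ⟨C, fun n z hz hzR => ?_⟩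
    have hz' : 0 < ‖z‖ := norm_pos_iff.2 hz
    have hle : ‖z‖ ≤ √(‖z‖ ^ 2 + ε n ^ 2) := Real.le_sqrt_of_sq_le (by nlinarith [hεpos n])
    have hle' : √(‖z‖ ^ 2 + ε n ^ 2) ≤ R + 1 :=
      Real.sqrt_le_iff.2 ⟨by linarith, by nlinarith [hεpos n, hε1 n]⟩
    have hpow : (√(‖z‖ ^ 2 + ε n ^ 2)) ^ (-β) ≤ ‖z‖ ^ (-β) :=
      Real.rpow_le_rpow_of_nonpos hz' hle (by linarith)
    have hmul := mul_le_mul_of_nonneg_left hpow hC0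
    have := hC _ ⟨hz'.trans_le hle, hle'⟩
    exact ⟨this.1.trans hmul, this.2.trans hmul⟩
  have hlimρ : ∀ z : Euc m, Tendsto (fun n => √(‖z‖ ^ 2 + ε n ^ 2)) atTop (𝓝 ‖z‖) := fun z => by
    have : Tendsto (fun e : ℝ => √(‖z‖ ^ 2 + e ^ 2)) (𝓝 0) (𝓝 √(‖z‖ ^ 2 + 0 ^ 2)) :=
      Continuous.tendsto (by fun_prop) 0
    simpa [Function.comp_def] using this.comp hεlim
  have hdim : Module.finrank ℝ (Euc m) = m := by simp
  obtain ⟨hκ, hfκ⟩ := locallyIntegrable_and_tendsto_of_le_rpow (μ := (volume : Measure (Euc m)))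
    (h := fun z => k ‖z‖) (hn := f) (β := β) (by omega) (by rwa [hdim])
    (fun n => (hfC n).continuous)
    (fun z hz => (hk1.continuousOn.continuousAt (Ioi_mem_nhds (norm_pos_iff.2 hz))).tendsto.comp
      (hlimρ z))
    (fun R => (hbound R).imp fun C hC n z hz hzR => (hC n z hz hzR).1)
  obtain ⟨hg, hfg⟩ := locallyIntegrable_and_tendsto_of_le_rpow (μ := (volume : Measure (Euc m)))
    (h := fderiv ℝ (fun z : Euc m => k ‖z‖)) (hn := fun n => fderiv ℝ (f n)) (β := β)
    (by omega) (by rwa [hdim])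
    (fun n => (hfC n).continuous_fderiv one_ne_zero)
    (fun z hz => by
      simp only [hfd, hgd z hz]
      have : ContinuousAt (fun e => radialFDeriv k e z) 0 :=
        continuousAt_radialFDeriv hdc continuousAt_id continuousAt_const (by simp [hz])
      exact this.tendsto.comp hεlim)
    (fun R => (hbound R).imp fun C hC n z hz hzR => by
      rw [hfd]
      exact (norm_radialFDeriv_le _ _ _).trans (hC n z hz hzR).2)
  refine ⟨hg, ?_⟩
  have hpot : pot k Ω = fun x => ∫ y in Ω, k ‖x - y‖ := by
    funext x
    simp only [pot, dist_eq_norm]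
  rw [hpot]
  exact hasFDerivAt_integral_comp_sub_left_of_tendsto hfC hκ hg hfκ hfg hΩ

/-- `C¹` regularity of the potential and differentiation under the integral sign. -/
theorem potential_contDiff_one {m : ℕ} (Ω : Set (Euc m)) (hΩ : IsBody Ω)
    (k : ℝ → ℝ) (α : ℝ) (hα : 1 < α) (hk : CondC1 m α k) :
    ContDiff ℝ 1 (pot k Ω) ∧
    ∀ (x : Euc m) (j : Fin m),
      fderiv ℝ (pot k Ω) x (EuclideanSpace.single j 1) =
        ∫ y in Ω, fderiv ℝ (fun x' : Euc m => k (dist x' y)) x (EuclideanSpace.single j 1) := by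
  rcases Nat.eq_zero_or_pos m with rfl | hm
  · exact ⟨by
      rw [show pot k Ω = fun _ => pot k Ω 0 from funext fun x => by rw [Subsingleton.elim x 0]]
      exact contDiff_const, fun _ j => j.elim0⟩
  obtain ⟨hg, hcont, hderiv⟩ := hk.hasFDerivAt_pot hm hα hΩ.isCompact
  refine ⟨contDiff_one_iff_hasFDerivAt.2 ⟨_, hcont, hderiv⟩, fun x j => ?_⟩
  rw [(hderiv x).fderiv, ContinuousLinearMap.integral_apply
    (integrableOn_comp_sub_left hg hΩ.isCompact.isBounded x)]
  refine integral_congr_ae (ae_of_all _ fun y => ?_)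
  simp only [dist_eq_norm]
  rw [fderiv_comp_sub (f := fun z : Euc m => k ‖z‖)]
end
end

section
/- Let Ω be a body in ℝ^m and suppose the kernel k : (0,∞) → ℝ is strictly decreasing and satisfies condition (C⁰_α) for some α > 0. Then the potential K_Ω attains a maximum on ℝ^m, and every maximum point of K_Ω belongs to the convex hull of Ω. -/
open Set MeasureTheory Filter Asymptotics Metric
open scoped Topology RealInnerProductSpace

noncomputable section

/-- The convex join of two compact sets is compact. -/
theorem IsCompact.convexJoin {E : Type*} [AddCommGroup E] [Module ℝ E] [TopologicalSpace E]
    [ContinuousAdd E] [ContinuousSMul ℝ E] {s t : Set E} (hs : IsCompact s) (ht : IsCompact t) :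
    IsCompact (_root_.convexJoin ℝ s t) := by
  have h : _root_.convexJoin ℝ s t =
      (fun p : (E × E) × ℝ => (1 - p.2) • p.1.1 + p.2 • p.1.2) '' ((s ×ˢ t) ×ˢ Icc (0 : ℝ) 1) := by
    ext x
    simp only [mem_convexJoin, segment_eq_image, mem_image, mem_prod, Prod.exists]
    constructor
    · rintro ⟨a, ha, b, hb, θ, hθ, rfl⟩
      exact ⟨a, b, θ, ⟨⟨ha, hb⟩, hθ⟩, rfl⟩
    · rintro ⟨a, b, θ, ⟨⟨ha, hb⟩, hθ⟩, rfl⟩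
      exact ⟨a, ha, b, hb, θ, hθ, rfl⟩
  rw [h]
  exact ((hs.prod ht).prod isCompact_Icc).image (by fun_prop)

/-- The convex hull of a finite subset of `s` lies in an iterated convex join of `s`. -/
theorem convexHull_subset_iterate_convexJoin {E : Type*} [AddCommGroup E] [Module ℝ E]
    {s : Set E} (n : ℕ) (t : Finset E) (hts : (t : Set E) ⊆ s) (hcard : t.card ≤ n + 1) :
    convexHull ℝ (t : Set E) ⊆ (convexJoin ℝ s)^[n] s := by
  classical
  induction n generalizing t with
  | zero =>
    obtain rfl | ⟨a, ha⟩ := t.eq_empty_or_nonempty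
    · simp
    · rw [Finset.card_le_one.mp hcard |> fun h => Finset.eq_singleton_iff_unique_mem.2
        ⟨ha, fun x hx => h x hx a ha⟩]
      simpa using hts ha
  | succ n ih =>
    obtain rfl | ⟨a, ha⟩ := t.eq_empty_or_nonempty
    · simp
    rw [Function.iterate_succ_apply', ← Finset.insert_erase ha, Finset.coe_insert]
    have hsub : ((t.erase a : Finset E) : Set E) ⊆ s :=
      (Finset.coe_subset.2 (t.erase_subset a)).trans hts
    have hc : (t.erase a).card ≤ n + 1 := by rw [Finset.card_erase_of_mem ha]; omega
    obtain h | h := (t.erase a).eq_empty_or_nonempty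
    · have h₁ := ih {a} (by simpa using hts ha) (by simp)
      have haC : a ∈ (convexJoin ℝ s)^[n] s := h₁ (by simp)
      rw [h]
      rintro x hx
      obtain rfl : x = a := by simpa using hx
      exact mem_convexJoin.2 ⟨x, hts ha, x, haC, left_mem_segment _ _ _⟩
    · rw [convexHull_insert (by exact_mod_cast h)]
      exact convexJoin_mono (by simpa using hts ha) (ih _ hsub hc)

/-- In finite dimension, the convex hull of a compact set is compact. -/
theorem IsCompact.convexHull_of_finiteDimensional {E : Type*} [AddCommGroup E] [Module ℝ E]
    [TopologicalSpace E] [ContinuousAdd E] [ContinuousSMul ℝ E] [FiniteDimensional ℝ E]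
    {s : Set E} (hs : IsCompact s) : IsCompact (convexHull ℝ s) := by
  have h : convexHull ℝ s = (_root_.convexJoin ℝ s)^[Module.finrank ℝ E] s := by
    apply Subset.antisymm
    · rw [convexHull_eq_union]
      refine iUnion₂_subset fun t ht => iUnion_subset fun hind => ?_
      refine convexHull_subset_iterate_convexJoin _ t ht ?_
      have h₁ := hind.card_le_finrank_succ
      rw [Fintype.card_coe] at h₁
      exact h₁.trans (Nat.add_le_add_right (Submodule.finrank_le _) 1)
    · generalize Module.finrank ℝ E = n
      induction n with
      | zero => exact subset_convexHull ℝ s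
      | succ n ih =>
        rw [Function.iterate_succ_apply']
        exact convexJoin_subset (subset_convexHull ℝ s) ih (convex_convexHull ℝ s)
  rw [h]
  generalize Module.finrank ℝ E = n
  induction n with
  | zero => exact hs
  | succ n ih =>
    rw [Function.iterate_succ_apply']
    exact hs.convexJoin ih

/-- Condition `(C⁰_α)` bounds the kernel near `0` by a power `r ^ (β - m)` with `β > 0`. -/
theorem CondC0.exists_isBigO_rpow {m : ℕ} {α : ℝ} {k : ℝ → ℝ} (hm : 0 < m) (hα : 0 < α)
    (hk : CondC0 m α k) : ∃ β : ℝ, 0 < β ∧ k =O[𝓝[>] (0:ℝ)] fun r : ℝ => r ^ (β - m) := by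
  have hm' : (0:ℝ) < m := by exact_mod_cast hm
  obtain ⟨-, h₁, h₂, h₃⟩ := hk
  rcases lt_trichotomy α m with h | h | h
  · exact ⟨α, hα, h₁ h⟩
  · exact ⟨m / 2, by positivity,
      (h₂ h).trans (isLittleO_log_rpow_nhdsGT_zero (by linarith)).isBigO⟩
  · exact ⟨m, hm', by simpa using h₃ h⟩

/-- The truncated radial kernel is integrable. -/
theorem CondC0.integrable_indicator_norm {m : ℕ} {α : ℝ} {k : ℝ → ℝ} (hm : 0 < m) (hα : 0 < α)
    (hk : CondC0 m α k) (R : ℝ) :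
    Integrable (fun z : Euc m => (Ioo 0 R).indicator k ‖z‖) := by
  have : Nonempty (Fin m) := ⟨⟨0, hm⟩⟩
  rw [integrable_fun_norm_addHaar volume (f := (Ioo 0 R).indicator k)]
  simp only [finrank_euclideanSpace, Fintype.card_fin, smul_eq_mul]
  obtain ⟨β, hβ, hO⟩ := hk.exists_isBigO_rpow hm hα
  have hcont : ContinuousOn (fun r : ℝ => r ^ (m - 1) * k r) (Ioi 0) :=
    (continuous_pow _).continuousOn.mul hk.1
  obtain ⟨C, hC⟩ := hO.bound
  obtain ⟨ε, hε, hεC⟩ := mem_nhdsGT_iff_exists_Ioo_subset.1 hC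
  simp only [mem_Ioi] at hε
  have h₁ : IntegrableOn (fun r : ℝ => r ^ (m - 1) * k r) (Ioo 0 ε) := by
    have hint : IntegrableOn (fun r : ℝ => C * r ^ (β - 1)) (Ioo 0 ε) := by
      have h := intervalIntegral.intervalIntegrable_rpow' (a := 0) (b := ε)
        (r := β - 1) (by linarith)
      rw [intervalIntegrable_iff_integrableOn_Ioo_of_le hε.le] at h
      exact h.const_mul C
    refine Integrable.mono' hint
      ((hcont.mono Ioo_subset_Ioi_self).aestronglyMeasurable measurableSet_Ioo) ?_
    filter_upwards [ae_restrict_mem measurableSet_Ioo] with r hr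
    have hb : ‖k r‖ ≤ C * ‖r ^ (β - m)‖ := hεC hr
    rw [norm_mul, Real.norm_of_nonneg (pow_nonneg hr.1.le _)]
    rw [Real.norm_of_nonneg (Real.rpow_nonneg hr.1.le _)] at hb
    calc r ^ (m - 1) * ‖k r‖ ≤ r ^ (m - 1) * (C * r ^ (β - m)) :=
          mul_le_mul_of_nonneg_left hb (pow_nonneg hr.1.le _)
      _ = C * (r ^ ((m - 1 : ℕ) : ℝ) * r ^ (β - m)) := by rw [Real.rpow_natCast]; ring
      _ = C * r ^ (β - 1) := by
          rw [← Real.rpow_add hr.1]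
          push_cast [Nat.cast_sub (Nat.one_le_iff_ne_zero.2 hm.ne')]
          ring_nf
  have h₂ : IntegrableOn (fun r : ℝ => r ^ (m - 1) * k r) (Icc ε R) :=
    (hcont.mono fun r hr => hε.trans_le hr.1).integrableOn_Icc
  have h₃ : IntegrableOn (fun r : ℝ => r ^ (m - 1) * k r) (Ioo 0 R) :=
    (h₁.union h₂).mono_set fun r hr => by
      rcases lt_or_ge r ε with h | h
      · exact Or.inl ⟨hr.1, h⟩
      · exact Or.inr ⟨h, hr.2.le⟩
  have h₄ : (fun r : ℝ => r ^ (m - 1) * (Ioo 0 R).indicator k r) =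
      (Ioo 0 R).indicator fun r : ℝ => r ^ (m - 1) * k r := by
    ext r
    by_cases hr : r ∈ Ioo 0 R <;> simp [hr]
  rw [h₄]
  exact (h₃.integrable_indicator measurableSet_Ioo).integrableOn

theorem CondC0.integrableOn_dist {m : ℕ} {α : ℝ} {k : ℝ → ℝ} (hm : 0 < m) (hα : 0 < α)
    (hk : CondC0 m α k) {Ω : Set (Euc m)} (hΩ : IsCompact Ω) (x : Euc m) :
    IntegrableOn (fun y => k (dist x y)) Ω := by
  have : Nonempty (Fin m) := ⟨⟨0, hm⟩⟩
  obtain ⟨R, hR⟩ := hΩ.isBounded.subset_ball x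
  have h := ((hk.integrable_indicator_norm hm hα R).comp_sub_left x).integrableOn (s := Ω)
  refine h.congr ?_
  filter_upwards [ae_restrict_mem hΩ.measurableSet,
    ae_restrict_of_ae (Measure.ae_ne volume x)] with y hy hyx
  rw [← dist_eq_norm, indicator_of_mem]
  exact ⟨dist_pos.2 hyx.symm, by simpa [dist_comm] using hR hy⟩

theorem continuous_pot {m : ℕ} {α : ℝ} {k : ℝ → ℝ} (hm : 0 < m) (hα : 0 < α)
    (hk : CondC0 m α k) (hdec : StrictAntiOn k (Ioi 0)) {Ω : Set (Euc m)} (hΩ : IsCompact Ω) :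
    Continuous (pot k Ω) := by
  have : Nonempty (Fin m) := ⟨⟨0, hm⟩⟩
  set δ : ℕ → ℝ := fun n => 1 / ((n : ℝ) + 1) with hδdef
  have hδ : ∀ n, 0 < δ n := fun n => by positivity
  have hδ1 : ∀ n, δ n ≤ 1 := fun n => by
    rw [hδdef]
    exact div_le_one_of_le₀ (by simp) (by positivity)
  set D : ℕ → Euc m → ℝ := fun n z => (Ioo 0 (δ n)).indicator (fun r => k r - k (δ n)) ‖z‖
    with hD
  have hDint : ∀ n, Integrable (D n) := fun n => by
    have h : CondC0 m m (fun _ => k (δ n)) :=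
      ⟨continuousOn_const, fun h => (lt_irrefl _ h).elim, fun _ => ?_,
        fun h => (lt_irrefl _ h).elim⟩
    · have := (hk.integrable_indicator_norm hm hα (δ n)).sub
        (h.integrable_indicator_norm hm (by exact_mod_cast hm) (δ n))
      refine this.congr (ae_of_all _ fun z => ?_)
      simp only [hD, Pi.sub_apply]
      by_cases hz : ‖z‖ ∈ Ioo 0 (δ n) <;> simp [hz]
    · exact (isLittleO_const_left.2 (Or.inr
        (tendsto_abs_atBot_atTop.comp Real.tendsto_log_nhdsGT_zero))).isBigO
  have hD0 : ∀ n z, 0 ≤ D n z := fun n z =>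
    indicator_nonneg (fun r hr => sub_nonneg.2 (hdec.antitoneOn hr.1 (hδ n) hr.2.le)) _
  have hDle : ∀ n z, D n z ≤ D 0 z := fun n z => by
    by_cases hz : ‖z‖ ∈ Ioo 0 (δ n)
    · have hz0 : ‖z‖ ∈ Ioo 0 (δ 0) := ⟨hz.1, hz.2.trans_le ((hδ1 n).trans (by simp [hδdef]))⟩
      simp only [hD, indicator_of_mem hz, indicator_of_mem hz0]
      exact sub_le_sub_left
        (hdec.antitoneOn (hδ n) (hδ 0) ((hδ1 n).trans (by simp [hδdef]))) _
    · have : D n z = 0 := indicator_of_notMem hz _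
      rw [this]
      exact hD0 0 z
  have hδlim : Tendsto δ atTop (𝓝 0) := tendsto_one_div_add_atTop_nhds_zero_nat
  have hlim : Tendsto (fun n => ∫ z, D n z) atTop (𝓝 0) := by
    have h := tendsto_integral_of_dominated_convergence (F := D) (f := fun _ => 0) (D 0)
      (fun n => (hDint n).aestronglyMeasurable) (hDint 0)
      (fun n => ae_of_all _ fun z => by
        rw [Real.norm_of_nonneg (hD0 n z)]
        exact hDle n z)
      (ae_of_all _ fun z => ?_)
    · simpa using h
    · refine tendsto_const_nhds.congr' ?_
      rcases eq_or_ne z 0 with rfl | hz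
      · exact Eventually.of_forall fun n => by simp [hD]
      · filter_upwards [hδlim.eventually_lt_const (norm_pos_iff.2 hz)] with n hn
        exact (indicator_of_notMem (fun h => (h.2.trans hn).false) _).symm
  have hcont : ∀ n, Continuous fun x : Euc m => ∫ y in Ω, k (max (dist x y) (δ n)) := fun n => by
    refine continuous_parametric_integral_of_continuous
      (f := fun x y : Euc m => k (max (dist x y) (δ n))) ?_ hΩ
    exact hk.1.comp_continuous (f := fun p : Euc m × Euc m => max (dist p.1 p.2) (δ n))
      (by fun_prop) fun p => lt_max_of_lt_right (hδ n)
  have happrox : ∀ n x, pot k Ω x - ∫ y in Ω, k (max (dist x y) (δ n)) =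
      ∫ y in Ω, D n (x - y) := fun n x => by
    rw [pot, ← integral_sub (hk.integrableOn_dist hm hα hΩ x)]
    · refine integral_congr_ae ?_
      filter_upwards [ae_restrict_of_ae (Measure.ae_ne volume x)] with y hyx
      have hpos : 0 < dist x y := dist_pos.2 hyx.symm
      simp only [hD, ← dist_eq_norm]
      rcases lt_or_ge (dist x y) (δ n) with h | h
      · rw [indicator_of_mem (show dist x y ∈ Ioo 0 (δ n) from ⟨hpos, h⟩), max_eq_right h.le]
      · rw [indicator_of_notMem fun h' => (h'.2.trans_le h).false, max_eq_left h, sub_self]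
    · exact (hk.1.comp_continuous (f := fun y => max (dist x y) (δ n)) (by fun_prop)
        fun p => lt_max_of_lt_right (hδ n)).continuousOn.integrableOn_compact hΩ
  refine TendstoUniformly.continuous (p := atTop)
    (F := fun n x => ∫ y in Ω, k (max (dist x y) (δ n))) ?_ (Frequently.of_forall hcont)
  rw [Metric.tendstoUniformly_iff]
  intro ε hε
  filter_upwards [hlim.eventually_lt_const hε] with n hn x
  rw [Real.dist_eq, happrox, abs_of_nonneg (integral_nonneg fun y => hD0 n _)]
  refine lt_of_le_of_lt ?_ hn
  calc ∫ y in Ω, D n (x - y) ≤ ∫ y, D n (x - y) :=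
        setIntegral_le_integral ((hDint n).comp_sub_left x) (ae_of_all _ fun y => hD0 n _)
    _ = ∫ z, D n z := integral_sub_left_eq_self _ _ x

/-- Every point outside a nonempty closed convex set has a point of the set strictly closer to all
points of the set. -/
theorem exists_mem_forall_dist_lt_of_notMem {E : Type*} [NormedAddCommGroup E]
    [InnerProductSpace ℝ E] {C : Set E} (hne : C.Nonempty) (hcomp : IsComplete C)
    (hconv : Convex ℝ C) {x : E} (hx : x ∉ C) : ∃ p ∈ C, ∀ y ∈ C, dist p y < dist x y := by
  obtain ⟨p, hp, hmin⟩ := exists_norm_eq_iInf_of_complete_convex hne hcomp hconv x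
  rw [norm_eq_iInf_iff_real_inner_le_zero hconv hp] at hmin
  refine ⟨p, hp, fun y hy => ?_⟩
  have hxp : 0 < ‖x - p‖ := norm_pos_iff.2 (sub_ne_zero.2 fun h => hx (h ▸ hp))
  have h := hmin y hy
  have h₁ : ‖x - y‖ ^ 2 = ‖x - p‖ ^ 2 - 2 * ⟪x - p, y - p⟫ + ‖y - p‖ ^ 2 := by
    rw [← norm_sub_sq_real, sub_sub_sub_cancel_right]
  rw [dist_comm p y, dist_eq_norm, dist_eq_norm]
  exact lt_of_pow_lt_pow_left₀ 2 (norm_nonneg _) (by nlinarith)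

theorem exists_mem_convexHull_pot_lt {m : ℕ} {α : ℝ} {k : ℝ → ℝ} (hm : 0 < m) (hα : 0 < α)
    (hk : CondC0 m α k) (hdec : StrictAntiOn k (Ioi 0)) {Ω : Set (Euc m)} (hΩ : IsCompact Ω)
    (hvol : volume Ω ≠ 0) {x : Euc m} (hx : x ∉ convexHull ℝ Ω) :
    ∃ p ∈ convexHull ℝ Ω, pot k Ω x < pot k Ω p := by
  have : Nonempty (Fin m) := ⟨⟨0, hm⟩⟩
  have hne : Ω.Nonempty := nonempty_of_measure_ne_zero hvol
  obtain ⟨p, hp, hlt⟩ := exists_mem_forall_dist_lt_of_notMem hne.convexHull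
    hΩ.convexHull_of_finiteDimensional.isComplete (convex_convexHull ℝ Ω) hx
  refine ⟨p, hp, ?_⟩
  have hpos : ∀ᵐ y ∂volume.restrict Ω, 0 < k (dist p y) - k (dist x y) := by
    filter_upwards [ae_restrict_mem hΩ.measurableSet,
      ae_restrict_of_ae (Measure.ae_ne volume p)] with y hy hyp
    have h := hlt y (subset_convexHull ℝ Ω hy)
    have hpy : 0 < dist p y := dist_pos.2 hyp.symm
    exact sub_pos.2 (hdec hpy (hpy.trans h) h)
  have hp_int := hk.integrableOn_dist hm hα hΩ p
  have hx_int := hk.integrableOn_dist hm hα hΩ x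
  rw [← sub_pos, pot, pot, ← integral_sub hp_int hx_int,
    integral_pos_iff_support_of_nonneg_ae (hpos.mono fun y hy => hy.le) (hp_int.sub hx_int)]
  refine pos_iff_ne_zero.2 fun h0 => hvol ?_
  have hfalse : ∀ᵐ y ∂volume.restrict Ω, False := by
    filter_upwards [hpos, measure_eq_zero_iff_ae_notMem.1 h0] with y hy hy'
    exact hy' hy.ne'
  rw [eventually_false_iff_eq_bot, ae_eq_bot] at hfalse
  exact Measure.restrict_eq_zero.1 hfalse

/-- existence of a maximum of the potential, located in the convex hull. -/
theorem potential_exists_max_in_convexHull {m : ℕ} (Ω : Set (Euc m)) (hΩ : IsBody Ω)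
    (k : ℝ → ℝ) (hdec : StrictAntiOn k (Ioi 0)) (α : ℝ) (hα : 0 < α)
    (hk : CondC0 m α k) :
    (∃ x : Euc m, ∀ y : Euc m, pot k Ω y ≤ pot k Ω x) ∧
    ∀ x : Euc m, (∀ y : Euc m, pot k Ω y ≤ pot k Ω x) → x ∈ convexHull ℝ Ω := by
  obtain ⟨U, hUo, hUne, hUb, rfl⟩ := hΩ
  have hne : (closure U).Nonempty := hUne.closure
  rcases Nat.eq_zero_or_pos m with rfl | hm
  · obtain ⟨z, hz⟩ := hne.convexHull (𝕜 := ℝ)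
    exact ⟨⟨z, fun y => by rw [Subsingleton.elim y z]⟩,
      fun x _ => by rwa [Subsingleton.elim x z]⟩
  have hcomp : IsCompact (closure U) := hUb.isCompact_closure
  have hvol : volume (closure U) ≠ 0 :=
    fun h => (hUo.measure_pos volume hUne).ne' (measure_mono_null subset_closure h)
  have hout := fun x => exists_mem_convexHull_pot_lt hm hα hk hdec hcomp hvol (x := x)
  constructor
  · obtain ⟨x, hx, hmax⟩ := hcomp.convexHull_of_finiteDimensional.exists_isMaxOn hne.convexHull
      (continuous_pot hm hα hk hdec hcomp).continuousOn
    refine ⟨x, fun y => ?_⟩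
    by_cases hy : y ∈ convexHull ℝ (closure U)
    · exact hmax hy
    · obtain ⟨p, hp, hlt⟩ := hout y hy
      exact hlt.le.trans (hmax hp)
  · intro x hx
    by_contra hxC
    obtain ⟨p, -, hlt⟩ := hout x hxC
    exact (hx p).not_gt hlt
end
end

section
/- Let Ω be a body in ℝ^m. Then the minimum folding height l : S^{m−1} → ℝ of Ω is lower semi-continuous on the unit sphere S^{m−1}. -/
open Set MeasureTheory Filter Asymptotics Metric
open scoped Topology RealInnerProductSpace

noncomputable section

theorem inner_reflAt {m : ℕ} {v : Euc m} (hv : ‖v‖ = 1) (b : ℝ) (z : Euc m) :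
    ⟪reflAt v b z, v⟫ = 2 * b - ⟪z, v⟫ := by
  rw [reflAt, inner_add_left, real_inner_smul_left, real_inner_self_eq_norm_sq, hv]
  ring

/-- On a set contained in a ball around the origin, heights are bounded by the radius. -/
theorem abs_inner_le_of_subset_closedBall {m : ℕ} {Ω : Set (Euc m)} {R : ℝ}
    (hR : Ω ⊆ closedBall 0 R) {v : Euc m} (hv : ‖v‖ = 1) {z : Euc m} (hz : z ∈ Ω) :
    |⟪z, v⟫| ≤ R := by
  have h := abs_real_inner_le_norm z v
  rw [hv, mul_one] at h
  exact h.trans (mem_closedBall_zero_iff.mp (hR hz))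

theorem foldable_nonempty {m : ℕ} {Ω : Set (Euc m)} (hΩ : Bornology.IsBounded Ω)
    {v : Euc m} (hv : ‖v‖ = 1) :
    {a : ℝ | ∀ b ≥ a, reflAt v b '' upSet Ω v b ⊆ Ω}.Nonempty := by
  obtain ⟨R, hR⟩ := hΩ.subset_closedBall 0
  refine ⟨R + 1, fun b hb => ?_⟩
  rintro _ ⟨z, ⟨hz, hbz⟩, rfl⟩
  have := (abs_le.mp (abs_inner_le_of_subset_closedBall hR hv hz)).2
  linarith

theorem foldable_bddBelow {m : ℕ} {Ω : Set (Euc m)} (hne : Ω.Nonempty)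
    (hΩ : Bornology.IsBounded Ω) {v : Euc m} (hv : ‖v‖ = 1) :
    BddBelow {a : ℝ | ∀ b ≥ a, reflAt v b '' upSet Ω v b ⊆ Ω} := by
  obtain ⟨R, hR⟩ := hΩ.subset_closedBall 0
  obtain ⟨z, hz⟩ := hne
  refine ⟨-R - 1, fun a ha => ?_⟩
  by_contra! hlt
  have hzR := abs_le.mp (abs_inner_le_of_subset_closedBall hR hv hz)
  have hmem : reflAt v (-R - 1) z ∈ Ω :=
    ha _ hlt.le ⟨z, ⟨hz, by linarith⟩, rfl⟩
  have h := (abs_le.mp (abs_inner_le_of_subset_closedBall hR hv hmem)).1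
  rw [inner_reflAt hv] at h
  linarith

/-- A point whose reflection at height `b` leaves `Ω` bounds the folding height below by `b`. -/
theorem le_foldHeight {m : ℕ} {Ω : Set (Euc m)} (hΩ : Bornology.IsBounded Ω)
    {v : Euc m} (hv : ‖v‖ = 1) {b : ℝ} {z : Euc m} (hz : z ∈ upSet Ω v b)
    (hb : reflAt v b z ∉ Ω) : b ≤ foldHeight Ω v :=
  le_csInf (foldable_nonempty hΩ hv) fun _ ha =>
    le_of_not_ge fun hab => hb (ha b hab ⟨z, hz, rfl⟩)

/-- lower semi-continuity of the minimum folding height on the sphere. -/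
theorem foldHeight_lowerSemicontinuousOn {m : ℕ} (Ω : Set (Euc m)) (hΩ : IsBody Ω) :
    LowerSemicontinuousOn (foldHeight Ω) (sphere (0 : Euc m) 1) := by
  obtain ⟨U, -, hU, hUb, rfl⟩ := hΩ
  intro v₀ hv₀ c hc
  obtain ⟨a, hca, hav⟩ := exists_between hc
  have hna : a ∉ {a : ℝ | ∀ b ≥ a, reflAt v₀ b '' upSet (closure U) v₀ b ⊆ closure U} :=
    notMem_of_lt_csInf hav
      (foldable_bddBelow hU.closure hUb.closure (mem_sphere_zero_iff_norm.mp hv₀))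
  simp only [mem_ofPred_eq, not_forall, not_subset] at hna
  obtain ⟨b, hab, _, ⟨z, ⟨hz, hbz⟩, rfl⟩, hrefl⟩ := hna
  -- Keep the distance from `z` to the mirror fixed while the direction varies.
  let β : Euc m → ℝ := fun v => b + (⟪z, v⟫ - ⟪z, v₀⟫)
  have hβ : Continuous β := by fun_prop
  have hβ₀ : β v₀ = b := by simp [β]
  have hcont : Continuous fun v => reflAt v (β v) z := by
    unfold reflAt
    fun_prop
  have hheight : ∀ᶠ v in 𝓝 v₀, c < β v :=
    hβ.continuousAt.eventually_const_lt (by rw [hβ₀]; exact hca.trans_le hab)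
  have hleave : ∀ᶠ v in 𝓝 v₀, reflAt v (β v) z ∈ (closure U)ᶜ :=
    hcont.continuousAt.eventually_mem
      (isClosed_closure.isOpen_compl.mem_nhds (by rwa [hβ₀]))
  filter_upwards [self_mem_nhdsWithin, nhdsWithin_le_nhds hheight, nhdsWithin_le_nhds hleave]
    with v hv hcv hvU
  exact hcv.trans_le (le_foldHeight hUb.closure (mem_sphere_zero_iff_norm.mp hv)
    ⟨hz, by simp only [β]; linarith⟩ hvU)
end
end

section
/- Let m ≥ 2, let ω : [0,1] → [0,∞) be continuous and piecewise C¹ with t ↦ ω(t)^{m−1} concave on [0,1], and let Ω = {(y₁, ȳ) ∈ ℝ × ℝ^{m−1} : 0 ≤ y₁ ≤ 1, |ȳ| ≤ ω(y₁)} be a body. Then for every h > 0, Ω has a unique illuminating center of height h, i.e., the function x ↦ A_Ω(x,h) has exactly one maximum point in ℝ^m. -/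
open Set MeasureTheory Filter Asymptotics Metric
open scoped Topology RealInnerProductSpace

noncomputable section

lemma convexOn_mul_one_add_sq_rpow {k : ℝ} (hk : 0 ≤ k) :
    ConvexOn ℝ (Ici (0 : ℝ)) fun x => x * (1 + x ^ 2) ^ k := by
  have hd : ∀ x : ℝ, HasDerivAt (fun x : ℝ => x * (1 + x ^ 2) ^ k)
      ((1 + x ^ 2) ^ k * (1 + 2 * k * (1 - 1 / (1 + x ^ 2)))) x := by
    intro x
    have hpos : 0 < 1 + x ^ 2 := by positivity
    have h1 : HasDerivAt (fun x : ℝ => 1 + x ^ 2) (2 * x) x := by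
      simpa using (hasDerivAt_pow 2 x).const_add 1
    have h2 := (hasDerivAt_id x).mul (h1.rpow_const (p := k) (Or.inl hpos.ne'))
    refine h2.congr_deriv ?_
    rw [Real.rpow_sub hpos, Real.rpow_one]
    simp only [id]
    field_simp
    ring
  refine MonotoneOn.convexOn_of_deriv (convex_Ici 0)
    (fun x _ => (hd x).continuousAt.continuousWithinAt)
    (fun x _ => (hd x).differentiableAt.differentiableWithinAt) ?_
  rw [interior_Ici]
  intro x hx y hy hxy
  rw [(hd x).deriv, (hd y).deriv]
  have hx0 : 0 < x := hx
  have hsq : 1 + x ^ 2 ≤ 1 + y ^ 2 := by nlinarith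
  have h1 : 1 / (1 + y ^ 2) ≤ 1 / (1 + x ^ 2) :=
    one_div_le_one_div_of_le (by positivity) hsq
  have h2 : 1 / (1 + x ^ 2) ≤ 1 := by
    rw [div_le_one (by positivity)]; nlinarith
  refine mul_le_mul (Real.rpow_le_rpow (by positivity) hsq hk) ?_ ?_ (by positivity)
  · nlinarith [mul_le_mul_of_nonneg_left h1 hk]
  · nlinarith [mul_nonneg hk (sub_nonneg.2 h2)]

/-- The integrand of the potential on the axis of revolution: `w` is the radius of a slice and
`a` the distance from the slice to the observer. -/
def sliceKer (n : ℕ) (a w : ℝ) : ℝ :=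
  w ^ n / (a ^ 2 * (a ^ 2 + w ^ 2) ^ ((n : ℝ) / 2))

lemma sliceKer_pos {n : ℕ} {a w : ℝ} (ha : 0 < a) (hw : 0 < w) : 0 < sliceKer n a w := by
  unfold sliceKer; positivity

lemma inv_sqrt_sliceKer {n : ℕ} {a w : ℝ} (ha : 0 < a) (hw : 0 < w) :
    (√(sliceKer n a w))⁻¹ = a * (1 + (a / w) ^ 2) ^ ((n : ℝ) / 4) := by
  have h1 : (a ^ 2 + w ^ 2) ^ ((n : ℝ) / 2) = w ^ n * (1 + (a / w) ^ 2) ^ ((n : ℝ) / 2) := by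
    have : a ^ 2 + w ^ 2 = w ^ 2 * (1 + (a / w) ^ 2) := by field_simp; ring
    rw [this, Real.mul_rpow (by positivity) (by positivity), ← Real.rpow_natCast_mul hw.le]
    congr 1
    rw [← Real.rpow_natCast]
    congr 1
    push_cast; ring
  have h2 : sliceKer n a w = (a * (1 + (a / w) ^ 2) ^ ((n : ℝ) / 4))⁻¹ ^ 2 := by
    unfold sliceKer
    rw [h1, inv_pow, mul_pow, ← Real.rpow_mul_natCast (by positivity)]
    rw [show (n : ℝ) / 4 * (2 : ℕ) = n / 2 by push_cast; ring]
    field_simp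
  rw [h2, Real.sqrt_sq (by positivity), inv_inv]

lemma inv_sqrt_sliceKer_midpoint {n : ℕ} {a b c u v w : ℝ} (ha : 0 < a) (hb : 0 < b) (hc : 0 < c)
    (hu : 0 < u) (hv : 0 < v) (hc' : c ≤ (a + b) / 2) (hw : (u + v) / 2 ≤ w) :
    2 * (√(sliceKer n c w))⁻¹ ≤ (√(sliceKer n a u))⁻¹ + (√(sliceKer n b v))⁻¹ := by
  have hw0 : 0 < w := by linarith
  rw [inv_sqrt_sliceKer ha hu, inv_sqrt_sliceKer hb hv, inv_sqrt_sliceKer hc hw0]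
  have hk : (0 : ℝ) ≤ (n : ℝ) / 4 := by positivity
  have hmono : c * (1 + (c / w) ^ 2) ^ ((n : ℝ) / 4) ≤
      (a + b) / 2 * (1 + ((a + b) / (u + v)) ^ 2) ^ ((n : ℝ) / 4) := by
    have h1 : c / w ≤ (a + b) / (u + v) := by
      rw [div_le_div_iff₀ hw0 (by positivity)]
      nlinarith
    gcongr
  have hconv := @(convexOn_mul_one_add_sq_rpow hk).2 (a / u) (show 0 ≤ a / u by positivity)
    (b / v) (show 0 ≤ b / v by positivity) (u / (u + v)) (v / (u + v))
    (by positivity) (by positivity) (by field_simp)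
  have e1 : u / (u + v) * (a / u) + v / (u + v) * (b / v) = (a + b) / (u + v) := by
    field_simp
  simp only [smul_eq_mul] at hconv
  rw [e1] at hconv
  have h3 := mul_le_mul_of_nonneg_left hconv (show 0 ≤ u + v by positivity)
  have e2 : (u + v) * ((a + b) / (u + v) * (1 + ((a + b) / (u + v)) ^ 2) ^ ((n : ℝ) / 4)) =
      (a + b) * (1 + ((a + b) / (u + v)) ^ 2) ^ ((n : ℝ) / 4) := by field_simp
  have e3 : (u + v) * (u / (u + v) * (a / u * (1 + (a / u) ^ 2) ^ ((n : ℝ) / 4)) +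
      v / (u + v) * (b / v * (1 + (b / v) ^ 2) ^ ((n : ℝ) / 4))) =
      a * (1 + (a / u) ^ 2) ^ ((n : ℝ) / 4) + b * (1 + (b / v) ^ 2) ^ ((n : ℝ) / 4) := by
    field_simp
  rw [e2, e3] at h3
  linarith

lemma sqrt_sq_add_sq_midpoint (x y h : ℝ) :
    √(((x + y) / 2) ^ 2 + h ^ 2) ≤ (√(x ^ 2 + h ^ 2) + √(y ^ 2 + h ^ 2)) / 2 := by
  refine Real.sqrt_le_iff.2 ⟨by positivity, ?_⟩
  have hx : √(x ^ 2 + h ^ 2) ^ 2 = x ^ 2 + h ^ 2 := Real.sq_sqrt (by positivity)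
  have hy : √(y ^ 2 + h ^ 2) ^ 2 = y ^ 2 + h ^ 2 := Real.sq_sqrt (by positivity)
  have hxy : x * y + h ^ 2 ≤ √(x ^ 2 + h ^ 2) * √(y ^ 2 + h ^ 2) := by
    rw [← Real.sqrt_mul (by positivity)]
    apply Real.le_sqrt_of_sq_le
    nlinarith [sq_nonneg (x * h - y * h)]
  nlinarith

/-- If two positive densities on `[0, 1]` have the same mass as a third one that dominates their
`-1/2`-mean at midpoints, then they coincide. This is the equality case of the one-dimensional
Borell–Brascamp–Lieb inequality. -/
lemma eqOn_of_integral_le_of_midpoint {f g m : ℝ → ℝ} (hf : Continuous f) (hg : Continuous g)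
    (hm : Continuous m) (hf0 : ∀ t ∈ Ioo (0 : ℝ) 1, 0 < f t) (hg0 : ∀ t ∈ Ioo (0 : ℝ) 1, 0 < g t)
    (hm0 : ∀ t ∈ Ioo (0 : ℝ) 1, 0 < m t)
    (hmid : ∀ t ∈ Ioo (0 : ℝ) 1, ∀ r ∈ Ioo (0 : ℝ) 1,
      2 * (√(m ((t + r) / 2)))⁻¹ ≤ (√(f t))⁻¹ + (√(g r))⁻¹)
    (hfg : ∫ t in (0 : ℝ)..1, f t = ∫ t in (0 : ℝ)..1, g t)
    (hmf : ∫ t in (0 : ℝ)..1, m t ≤ ∫ t in (0 : ℝ)..1, f t) :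
    ∀ t ∈ Ioo (0 : ℝ) 1, f t = g t := by
  have hderiv : ∀ {k : ℝ → ℝ}, Continuous k → ∀ x,
      HasDerivAt (fun x => ∫ t in (0 : ℝ)..x, k t) (k x) x := fun hk x =>
    (hk.integral_hasStrictDerivAt 0 x).hasDerivAt
  have hstrict : ∀ {k : ℝ → ℝ}, Continuous k → (∀ t ∈ Ioo (0 : ℝ) 1, 0 < k t) →
      StrictMonoOn (fun x => ∫ t in (0 : ℝ)..x, k t) (Icc 0 1) := by
    intro k hk hk0
    refine strictMonoOn_of_deriv_pos (convex_Icc 0 1)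
      (fun x _ => (hderiv hk x).continuousAt.continuousWithinAt) ?_
    rw [interior_Icc]
    intro x hx
    rw [(hderiv hk x).deriv]
    exact hk0 x hx
  set F : ℝ → ℝ := fun x => ∫ t in (0 : ℝ)..x, f t with hF
  set G : ℝ → ℝ := fun x => ∫ t in (0 : ℝ)..x, g t with hG
  set M : ℝ → ℝ := fun x => ∫ t in (0 : ℝ)..x, m t with hM
  have hF0 : F 0 = 0 := by simp [hF]
  have hG0 : G 0 = 0 := by simp [hG]
  have hM0 : M 0 = 0 := by simp [hM]
  have hFG1 : F 1 = G 1 := hfg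
  have hFs : StrictMonoOn F (Icc 0 1) := hstrict hf hf0
  have hGs : StrictMonoOn G (Icc 0 1) := hstrict hg hg0
  have hGc : Continuous G := continuous_iff_continuousAt.2 fun x => (hderiv hg x).continuousAt
  have hFc : Continuous F := continuous_iff_continuousAt.2 fun x => (hderiv hf x).continuousAt
  have hMc : Continuous M := continuous_iff_continuousAt.2 fun x => (hderiv hm x).continuousAt
  have h01 : (0 : ℝ) ∈ Icc (0 : ℝ) 1 := by simp
  have h11 : (1 : ℝ) ∈ Icc (0 : ℝ) 1 := by simp
  have hG1 : 0 ≤ G 1 := by rw [← hG0]; exact hGs.monotoneOn h01 h11 zero_le_one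
  obtain ⟨S, hSc, hSmem, hGS⟩ : ∃ S : ℝ → ℝ, Continuous S ∧ (∀ u, S u ∈ Icc (0 : ℝ) 1) ∧
      ∀ u ∈ Icc 0 (G 1), G (S u) = u := by
    have himg : G '' Icc 0 1 = Icc 0 (G 1) := by
      apply Subset.antisymm
      · rintro _ ⟨x, hx, rfl⟩
        exact ⟨hG0 ▸ hGs.monotoneOn h01 hx hx.1, hGs.monotoneOn hx h11 hx.2⟩
      · have := intermediate_value_Icc zero_le_one (hGc.continuousOn (s := Icc 0 1))
        rwa [hG0] at this
    let e := (hGs.orderIso G (Icc 0 1)).trans (OrderIso.setCongr _ _ himg)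
    refine ⟨fun u => e.symm (projIcc 0 (G 1) hG1 u), ?_, fun u => (e.symm _).2, ?_⟩
    · exact continuous_subtype_val.comp (e.symm.continuous.comp continuous_projIcc)
    · intro u hu
      have : ((e (e.symm (projIcc 0 (G 1) hG1 u)) : Icc 0 (G 1)) : ℝ) = u := by
        rw [OrderIso.apply_symm_apply, projIcc_of_mem hG1 hu]
      exact this
  set T : ℝ → ℝ := fun t => S (F t) with hT
  have hFmem : ∀ t ∈ Icc (0 : ℝ) 1, F t ∈ Icc 0 (G 1) := fun t ht =>
    ⟨hF0 ▸ hFs.monotoneOn h01 ht ht.1, hFG1 ▸ hFs.monotoneOn ht h11 ht.2⟩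
  have hFmem' : ∀ t ∈ Ioo (0 : ℝ) 1, F t ∈ Ioo 0 (G 1) := fun t ht =>
    ⟨hF0 ▸ hFs h01 (Ioo_subset_Icc_self ht) ht.1, hFG1 ▸ hFs (Ioo_subset_Icc_self ht) h11 ht.2⟩
  have hGT : ∀ t ∈ Icc (0 : ℝ) 1, G (T t) = F t := fun t ht => hGS _ (hFmem t ht)
  have hT0 : T 0 = 0 := hGs.injOn (hSmem _) h01 (by rw [hGT 0 h01, hF0, hG0])
  have hT1 : T 1 = 1 := hGs.injOn (hSmem _) h11 (by rw [hGT 1 h11, hFG1])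
  have hTmem : ∀ t ∈ Ioo (0 : ℝ) 1, T t ∈ Ioo (0 : ℝ) 1 := by
    intro t ht
    have h1 := hGT t (Ioo_subset_Icc_self ht)
    have h2 := hFmem' t ht
    refine ⟨lt_of_le_of_ne (hSmem _).1 fun h => ?_, lt_of_le_of_ne (hSmem _).2 fun h => ?_⟩
    · rw [show T t = 0 from h.symm, hG0] at h1
      exact h2.1.ne h1
    · rw [show T t = 1 from h] at h1
      exact h2.2.ne h1.symm
  have hTd : ∀ t ∈ Ioo (0 : ℝ) 1, HasDerivAt T (f t / g (T t)) t := by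
    intro t ht
    have h1 : HasDerivAt S (g (T t))⁻¹ (F t) := by
      refine HasDerivAt.of_local_left_inverse hSc.continuousAt (hderiv hg _)
        (hg0 _ (hTmem t ht)).ne' ?_
      filter_upwards [Icc_mem_nhds (hFmem' t ht).1 (hFmem' t ht).2] with u hu using hGS u hu
    exact (h1.comp t (hderiv hf t)).congr_deriv (by ring)
  have hTc : Continuous T := hSc.comp hFc
  set D : ℝ → ℝ := fun t => M ((t + T t) / 2) - F t with hD
  have hDd : ∀ t ∈ Ioo (0 : ℝ) 1,
      HasDerivAt D (m ((t + T t) / 2) * ((1 + f t / g (T t)) / 2) - f t) t := fun t ht =>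
    (((hderiv hm _).comp t (((hasDerivAt_id t).add (hTd t ht)).div_const 2))).sub (hderiv hf t)
  have key : ∀ t ∈ Ioo (0 : ℝ) 1,
      0 ≤ m ((t + T t) / 2) * ((1 + f t / g (T t)) / 2) - f t ∧
      (m ((t + T t) / 2) * ((1 + f t / g (T t)) / 2) - f t = 0 → f t = g (T t)) := by
    intro t ht
    have hTt := hTmem t ht
    have hz : (t + T t) / 2 ∈ Ioo (0 : ℝ) 1 :=
      ⟨by linarith [ht.1, hTt.1], by linarith [ht.2, hTt.2]⟩
    have hineq := hmid t ht _ hTt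
    have p1 := Real.sqrt_pos.2 (hf0 t ht)
    have p2 := Real.sqrt_pos.2 (hg0 _ hTt)
    have p3 := Real.sqrt_pos.2 (hm0 _ hz)
    rw [← Real.sq_sqrt (hf0 t ht).le, ← Real.sq_sqrt (hg0 _ hTt).le, ← Real.sq_sqrt (hm0 _ hz).le]
    generalize √(f t) = a at *
    generalize √(g (T t)) = b at *
    generalize √(m ((t + T t) / 2)) = c at *
    have h1 : 2 * a * b ≤ (a + b) * c := by
      have := mul_le_mul_of_nonneg_left hineq (show 0 ≤ a * b * c by positivity)
      have e1 : a * b * c * (2 * c⁻¹) = 2 * a * b := by field_simp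
      have e2 : a * b * c * (a⁻¹ + b⁻¹) = (a + b) * c := by field_simp; ring
      rwa [e1, e2] at this
    have h2 : c ^ 2 * ((1 + a ^ 2 / b ^ 2) / 2) - a ^ 2 =
        (c ^ 2 * (a ^ 2 + b ^ 2) - 2 * a ^ 2 * b ^ 2) / (2 * b ^ 2) := by
      field_simp; ring
    have h3 : (2 * a * b) ^ 2 ≤ ((a + b) * c) ^ 2 := by gcongr
    have h4 : c ^ 2 * (a - b) ^ 2 ≤ 2 * (c ^ 2 * (a ^ 2 + b ^ 2) - 2 * a ^ 2 * b ^ 2) := by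
      nlinarith
    constructor
    · rw [h2]
      have : 0 ≤ c ^ 2 * (a - b) ^ 2 := by positivity
      exact div_nonneg (by linarith) (by positivity)
    · intro h0
      rw [h2, div_eq_zero_iff] at h0
      have h5 : c ^ 2 * (a ^ 2 + b ^ 2) - 2 * a ^ 2 * b ^ 2 = 0 :=
        h0.resolve_right (by positivity)
      rw [h5] at h4
      have h6 : (a - b) ^ 2 ≤ 0 := by
        by_contra! hcon
        have : 0 < c ^ 2 * (a - b) ^ 2 := by positivity
        linarith
      have h7 : a - b = 0 := pow_eq_zero_iff two_ne_zero |>.1 (le_antisymm h6 (sq_nonneg _))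
      rw [sub_eq_zero.1 h7]
  have hDc : Continuous D := (hMc.comp ((continuous_id.add hTc).div_const 2)).sub hFc
  have hDmono : MonotoneOn D (Icc 0 1) := by
    refine monotoneOn_of_deriv_nonneg (convex_Icc 0 1) hDc.continuousOn ?_ ?_
    · rw [interior_Icc]
      exact fun x hx => (hDd x hx).differentiableAt.differentiableWithinAt
    · rw [interior_Icc]
      intro x hx
      rw [(hDd x hx).deriv]
      exact (key x hx).1
  have hD0 : D 0 = 0 := by simp [hD, hT0, hM0, hF0]
  have hD1 : D 1 ≤ 0 := by
    have : D 1 = M 1 - F 1 := by simp [hD, hT1]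
    rw [this]
    exact sub_nonpos.2 hmf
  have hDzero : ∀ t ∈ Icc (0 : ℝ) 1, D t = 0 := fun t ht =>
    le_antisymm ((hDmono ht h11 ht.2).trans hD1) (hD0 ▸ hDmono h01 ht ht.1)
  have heq : ∀ t ∈ Ioo (0 : ℝ) 1, f t = g (T t) := by
    intro t ht
    refine (key t ht).2 ((hDd t ht).unique ?_)
    refine (hasDerivAt_const t (0 : ℝ)).congr_of_eventuallyEq ?_
    filter_upwards [Icc_mem_nhds ht.1 ht.2] with u hu using hDzero u hu
  have hTmono : MonotoneOn (fun t => T t - t) (Icc 0 1) := by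
    have hd : ∀ t ∈ Ioo (0 : ℝ) 1, HasDerivAt (fun t => T t - t) 0 t := by
      intro t ht
      refine ((hTd t ht).sub (hasDerivAt_id t)).congr_deriv ?_
      rw [heq t ht, div_self (hg0 _ (hTmem t ht)).ne', sub_self]
    refine monotoneOn_of_deriv_nonneg (convex_Icc 0 1) (hTc.sub continuous_id).continuousOn ?_ ?_
    · rw [interior_Icc]
      exact fun x hx => (hd x hx).differentiableAt.differentiableWithinAt
    · rw [interior_Icc]
      exact fun x hx => (hd x hx).deriv.ge
  intro t ht
  have h1 := hTmono h01 (Ioo_subset_Icc_self ht) ht.1.le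
  have h2 := hTmono (Ioo_subset_Icc_self ht) h11 ht.2.le
  simp only [hT0, hT1, sub_self] at h1 h2
  rw [heq t ht, show T t = t by linarith]

lemma continuous_sliceKer_sqrt (n : ℕ) {ω : ℝ → ℝ} (hω : Continuous ω) {h : ℝ} (hh : 0 < h) :
    Continuous fun p : ℝ × ℝ => sliceKer n √((p.1 - p.2) ^ 2 + h ^ 2) (ω p.2) := by
  unfold sliceKer
  refine Continuous.div (by fun_prop) ?_ fun p => by positivity
  refine Continuous.mul (by fun_prop) (Continuous.rpow_const (by fun_prop) fun p => Or.inl ?_)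
  positivity

lemma sliceKer_le_of_le {n : ℕ} {a b w : ℝ} (ha : 0 < a) (hab : a ≤ b) (hw : 0 ≤ w) :
    sliceKer n b w ≤ sliceKer n a w := by
  unfold sliceKer
  gcongr

lemma existsUnique_isMax_integral_sliceKer (n : ℕ) {ω : ℝ → ℝ} (hω : Continuous ω)
    (hpos : ∀ t ∈ Ioo (0 : ℝ) 1, 0 < ω t) (hnonneg : ∀ t ∈ Icc (0 : ℝ) 1, 0 ≤ ω t)
    (hmid : ∀ t ∈ Icc (0 : ℝ) 1, ∀ r ∈ Icc (0 : ℝ) 1, (ω t + ω r) / 2 ≤ ω ((t + r) / 2))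
    {h : ℝ} (hh : 0 < h) :
    ∃! s : ℝ, ∀ s' : ℝ, ∫ t in (0 : ℝ)..1, sliceKer n √((s' - t) ^ 2 + h ^ 2) (ω t) ≤
      ∫ t in (0 : ℝ)..1, sliceKer n √((s - t) ^ 2 + h ^ 2) (ω t) := by
  have hK := continuous_sliceKer_sqrt n hω hh
  have hKs : ∀ s, Continuous fun t => sliceKer n √((s - t) ^ 2 + h ^ 2) (ω t) := fun s =>
    hK.comp (Continuous.prodMk_right s)
  set f : ℝ → ℝ := fun s => ∫ t in (0 : ℝ)..1, sliceKer n √((s - t) ^ 2 + h ^ 2) (ω t) with hf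
  have hfc : Continuous f :=
    intervalIntegral.continuous_parametric_intervalIntegral_of_continuous' (by exact hK) 0 1
  have hproj : ∀ s, ∃ s₀ ∈ Icc (0 : ℝ) 1, f s ≤ f s₀ := by
    intro s
    have haux : ∀ s₀, (∀ t ∈ Icc (0 : ℝ) 1, (s₀ - t) ^ 2 ≤ (s - t) ^ 2) → f s ≤ f s₀ := by
      intro s₀ hs₀
      refine intervalIntegral.integral_mono_on zero_le_one ((hKs s).intervalIntegrable _ _)
        ((hKs s₀).intervalIntegrable _ _) fun t ht => ?_
      exact sliceKer_le_of_le (by positivity) (Real.sqrt_le_sqrt (by linarith [hs₀ t ht]))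
        (hnonneg t ht)
    rcases le_total s 0 with hs | hs
    · exact ⟨0, by simp, haux 0 fun t ht => by nlinarith [ht.1]⟩
    rcases le_total s 1 with hs' | hs'
    · exact ⟨s, ⟨hs, hs'⟩, le_rfl⟩
    · exact ⟨1, by simp, haux 1 fun t ht => by nlinarith [ht.2]⟩
  obtain ⟨s, -, hs⟩ := isCompact_Icc.exists_isMaxOn (nonempty_Icc.2 zero_le_one)
    (hfc.continuousOn (s := Icc (0 : ℝ) 1))
  refine ⟨s, fun s' => ?_, fun r hr => ?_⟩
  · obtain ⟨s₀, hs₀, h'⟩ := hproj s'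
    exact h'.trans (hs hs₀)
  have hsmax : ∀ s', f s' ≤ f s := fun s' => by
    obtain ⟨s₀, hs₀, h'⟩ := hproj s'
    exact h'.trans (hs hs₀)
  have hrmax : ∀ s', f s' ≤ f r := hr
  have hsr : f r = f s := le_antisymm (hsmax r) (hrmax s)
  have heq := eqOn_of_integral_le_of_midpoint (hKs r) (hKs s) (hKs ((r + s) / 2))
    (fun t ht => sliceKer_pos (by positivity) (hpos t ht))
    (fun t ht => sliceKer_pos (by positivity) (hpos t ht))
    (fun t ht => sliceKer_pos (by positivity) (hpos t ht))
    (fun t ht u hu => by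
      refine inv_sqrt_sliceKer_midpoint (by positivity) (by positivity) (by positivity)
        (hpos t ht) (hpos u hu) ?_ (hmid t (Ioo_subset_Icc_self ht) u (Ioo_subset_Icc_self hu))
      rw [show (r + s) / 2 - (t + u) / 2 = ((r - t) + (s - u)) / 2 by ring]
      exact sqrt_sq_add_sq_midpoint _ _ _) hsr (hrmax _)
  have hsq : ∀ t ∈ Ioo (0 : ℝ) 1, (r - t) ^ 2 = (s - t) ^ 2 := by
    intro t ht
    have hstrict : ∀ {a b : ℝ}, 0 < a → a < b → sliceKer n b (ω t) < sliceKer n a (ω t) := by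
      intro a b ha hab
      have := hpos t ht
      unfold sliceKer
      have hb : 0 < b := ha.trans hab
      refine div_lt_div_of_pos_left (by positivity) (by positivity) ?_
      refine mul_lt_mul (by gcongr) (by gcongr) (by positivity) (by positivity)
    rcases lt_trichotomy ((r - t) ^ 2) ((s - t) ^ 2) with hlt | he | hgt
    · exact absurd (heq t ht)
        (hstrict (by positivity) (Real.sqrt_lt_sqrt (by positivity) (by linarith))).ne'
    · exact he
    · exact absurd (heq t ht)
        (hstrict (by positivity) (Real.sqrt_lt_sqrt (by positivity) (by linarith))).ne
  have h1 := hsq (1 / 4) (by norm_num)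
  have h2 := hsq (1 / 2) (by norm_num)
  linarith

lemma integral_closedBall_eq_sliceKer {n : ℕ} (hn : n ≠ 0) {a w : ℝ} (ha : 0 < a) (hw : 0 ≤ w) :
    ∫ z in closedBall (0 : EuclideanSpace ℝ (Fin n)) w,
        ((a ^ 2 + ‖z‖ ^ 2) ^ (((n : ℝ) + 2) / 2))⁻¹ =
      volume.real (ball (0 : EuclideanSpace ℝ (Fin n)) 1) * sliceKer n a w := by
  have : Nonempty (Fin n) := ⟨⟨0, Nat.pos_of_ne_zero hn⟩⟩
  set g : ℝ → ℝ := (Icc 0 w).indicator fun y => ((a ^ 2 + y ^ 2) ^ (((n : ℝ) + 2) / 2))⁻¹ with hg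
  have h1 : ∫ z in closedBall (0 : EuclideanSpace ℝ (Fin n)) w,
      ((a ^ 2 + ‖z‖ ^ 2) ^ (((n : ℝ) + 2) / 2))⁻¹ = ∫ z : EuclideanSpace ℝ (Fin n), g ‖z‖ := by
    rw [← integral_indicator measurableSet_closedBall]
    congr 1 with z
    by_cases hz : ‖z‖ ≤ w <;> simp [hg, indicator, hz]
  have hd : ∀ y : ℝ, HasDerivAt (fun y => sliceKer n a y)
      (n * (y ^ (n - 1) * ((a ^ 2 + y ^ 2) ^ (((n : ℝ) + 2) / 2))⁻¹)) y := by
    intro y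
    have hp : 0 < a ^ 2 + y ^ 2 := by positivity
    have e1 : HasDerivAt (fun y : ℝ => a ^ 2 + y ^ 2) (2 * y) y := by
      simpa using (hasDerivAt_pow 2 y).const_add (a ^ 2)
    have e2 := (hasDerivAt_pow n y).div
      ((e1.rpow_const (p := (n : ℝ) / 2) (Or.inl hp.ne')).const_mul (a ^ 2)) (by positivity)
    refine e2.congr_deriv ?_
    have e3 : (a ^ 2 + y ^ 2) ^ (((n : ℝ) + 2) / 2) =
        (a ^ 2 + y ^ 2) ^ ((n : ℝ) / 2) * (a ^ 2 + y ^ 2) := by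
      rw [show ((n : ℝ) + 2) / 2 = n / 2 + 1 by ring, Real.rpow_add_one hp.ne']
    obtain ⟨k, rfl⟩ := Nat.exists_eq_succ_of_ne_zero hn
    rw [e3, Real.rpow_sub_one hp.ne']
    simp only [Nat.succ_eq_add_one, Nat.add_sub_cancel, pow_succ y k]
    field_simp
    ring
  have hcont : Continuous fun y : ℝ =>
      n * (y ^ (n - 1) * ((a ^ 2 + y ^ 2) ^ (((n : ℝ) + 2) / 2))⁻¹) := by
    refine continuous_const.mul (Continuous.mul (by fun_prop) (Continuous.inv₀
      (Continuous.rpow_const (by fun_prop) fun y => Or.inl ?_) fun y => ?_)) <;> positivity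
  have h2 : ∫ y in Ioi (0 : ℝ), y ^ (n - 1) • g y =
      ∫ y in (0 : ℝ)..w, y ^ (n - 1) * ((a ^ 2 + y ^ 2) ^ (((n : ℝ) + 2) / 2))⁻¹ := by
    rw [intervalIntegral.integral_of_le hw, ← integral_indicator measurableSet_Ioi,
      ← integral_indicator measurableSet_Ioc]
    congr 1 with y
    by_cases h0 : 0 < y
    · by_cases hy : y ≤ w <;> simp [hg, indicator, h0, h0.le, hy]
    · simp [indicator, h0]
  have h3 : n * ∫ y in (0 : ℝ)..w, y ^ (n - 1) * ((a ^ 2 + y ^ 2) ^ (((n : ℝ) + 2) / 2))⁻¹ =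
      sliceKer n a w := by
    rw [← intervalIntegral.integral_const_mul,
      intervalIntegral.integral_eq_sub_of_hasDerivAt (fun y _ => hd y)
        (hcont.intervalIntegrable _ _)]
    simp [sliceKer, hn]
  rw [h1, integral_fun_norm_addHaar, finrank_euclideanSpace_fin, h2, nsmul_eq_mul, smul_eq_mul,
    mul_left_comm, h3]

/-- The moving plane comparison: if the part of `Ω` beyond the hyperplane halfway between `p` and
`p + v` folds into `Ω`, and `Ω` is symmetric in the parallel hyperplane through `p`, then the
potential is larger at `p` than at `p + v`. -/
lemma pot_add_lt_pot {m : ℕ} {κ : ℝ → ℝ} (hκ : Continuous κ) (hanti : StrictAntiOn κ (Ici 0))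
    {Ω : Set (Euc m)} (hbody : IsBody Ω) {p v : Euc m} (hv : v ≠ 0) (hpv : ⟪p, v⟫ = 0)
    (hsymm : ∀ y ∈ Ω, y - (2 * ⟪y, v⟫ / ‖v‖ ^ 2) • v ∈ Ω)
    (hfold : ∀ y ∈ Ω, 1 - 2 * ⟪y, v⟫ / ‖v‖ ^ 2 ≤ 0 →
      y + (1 - 2 * ⟪y, v⟫ / ‖v‖ ^ 2) • v ∈ Ω) :
    pot κ Ω (p + v) < pot κ Ω p := by
  obtain ⟨U, hUo, hUne, hUb, hUΩ⟩ := hbody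
  have hΩc : IsCompact Ω := by rw [hUΩ]; exact hUb.isCompact_closure
  have hv2 : 0 < ‖v‖ ^ 2 := by positivity
  set R : Euc m → Euc m := fun y => y + (1 - 2 * ⟪y, v⟫ / ‖v‖ ^ 2) • v with hR
  have hRinner : ∀ y, ⟪R y, v⟫ = ‖v‖ ^ 2 - ⟪y, v⟫ := by
    intro y
    simp only [hR, inner_add_left, real_inner_smul_left, real_inner_self_eq_norm_sq]
    field_simp
    ring
  have hRR : ∀ y, R (R y) = y := by
    intro y
    have h1 : R (R y) = R y + (1 - 2 * ⟪R y, v⟫ / ‖v‖ ^ 2) • v := rfl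
    rw [h1, hRinner]
    simp only [hR]
    rw [add_assoc, ← add_smul]
    have : 1 - 2 * ⟪y, v⟫ / ‖v‖ ^ 2 + (1 - 2 * (‖v‖ ^ 2 - ⟪y, v⟫) / ‖v‖ ^ 2) = 0 := by
      field_simp; ring
    rw [this, zero_smul, add_zero]
  have hRrefl : ∀ y, R y = (ℝ ∙ v)ᗮ.reflection y + v := by
    intro y
    rw [Submodule.reflection_orthogonal_apply, Submodule.reflection_singleton_apply,
      real_inner_comm y v]
    simp only [hR, RCLike.ofReal_real_eq_id, id]
    module
  have hRmp : MeasurePreserving R := by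
    have : R = (fun y => y + v) ∘ (ℝ ∙ v)ᗮ.reflection := funext hRrefl
    rw [this]
    exact (measurePreserving_add_right volume v).comp
      (LinearIsometryEquiv.measurePreserving _)
  have hRc : Continuous R := by
    have : R = fun y => (ℝ ∙ v)ᗮ.reflection y + v := funext hRrefl
    rw [this]; fun_prop
  have hRdist : ∀ y z, dist (R y) (R z) = dist y z := by
    intro y z
    rw [hRrefl, hRrefl, dist_add_right, LinearIsometryEquiv.dist_map]
  have hRemb : MeasurableEmbedding R := by
    let e : Euc m ≃ᵐ Euc m := ⟨⟨R, R, hRR, hRR⟩, hRc.measurable, hRc.measurable⟩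
    exact e.measurableEmbedding
  have hRp : R p = p + v := by simp [hR, hpv]
  have hdistsq : ∀ y, dist p (R y) ^ 2 = dist p y ^ 2 + (1 - 2 * ⟪y, v⟫ / ‖v‖ ^ 2) * ‖v‖ ^ 2 := by
    intro y
    rw [dist_comm p, dist_comm p, dist_eq_norm, dist_eq_norm]
    have : R y - p = (y - p) + (1 - 2 * ⟪y, v⟫ / ‖v‖ ^ 2) • v := by simp only [hR]; abel
    rw [this, norm_add_sq_real, real_inner_smul_right, inner_sub_left, hpv, norm_smul, mul_pow,
      Real.norm_eq_abs, sq_abs]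
    field_simp
    ring
  have hdist : ∀ y, dist (p + v) y = dist p (R y) := by
    intro y
    rw [← hRp, ← hRdist (R p) y, hRR]
  set k : Euc m → ℝ := fun y => κ (dist p y) with hk
  have hkc : Continuous k := by fun_prop
  have hkRc : Continuous fun y => k (R y) := hkc.comp hRc
  have hΩm : MeasurableSet Ω := hΩc.isClosed.measurableSet
  have hRm : MeasurableSet (R ⁻¹' Ω) := hRc.measurable hΩm
  have hint : ∀ {f : Euc m → ℝ}, Continuous f → IntegrableOn f Ω := fun hf =>
    hf.continuousOn.integrableOn_compact hΩc
  have hA : ∫ y in Ω ∩ R ⁻¹' Ω, k (R y) = ∫ y in Ω ∩ R ⁻¹' Ω, k y := by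
    have hpre : R ⁻¹' (Ω ∩ R ⁻¹' Ω) = Ω ∩ R ⁻¹' Ω := by
      ext y
      simp only [mem_preimage, mem_inter_iff, hRR]
      exact and_comm
    have := hRmp.setIntegral_preimage_emb hRemb k (Ω ∩ R ⁻¹' Ω)
    rwa [hpre] at this
  have hpos : 0 < ∫ y in Ω \ R ⁻¹' Ω, (k y - k (R y)) := by
    have hlt : ∀ y ∈ Ω \ R ⁻¹' Ω, 0 < k y - k (R y) := by
      intro y hy
      have hlam : 0 < 1 - 2 * ⟪y, v⟫ / ‖v‖ ^ 2 := by
        by_contra! hcon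
        exact hy.2 (hfold y hy.1 hcon)
      have hd : dist p y < dist p (R y) := by
        refine lt_of_pow_lt_pow_left₀ 2 dist_nonneg ?_
        rw [hdistsq]
        linarith [mul_pos hlam hv2]
      exact sub_pos.2 (hanti dist_nonneg dist_nonneg hd)
    rw [setIntegral_pos_iff_support_of_nonneg_ae]
    · obtain ⟨y₀, hy₀, hmin⟩ := hΩc.exists_isMinOn (by rw [hUΩ]; exact hUne.closure)
        (f := fun y => ⟪y, v⟫) (by fun_prop)
      have hsup : ∀ y ∈ Ω, ⟪y, v⟫ ≤ -⟪y₀, v⟫ := by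
        intro y hy
        have h1 : ⟪y₀, v⟫ ≤ ⟪y - (2 * ⟪y, v⟫ / ‖v‖ ^ 2) • v, v⟫ := hmin (hsymm y hy)
        rw [inner_sub_left, real_inner_smul_left, real_inner_self_eq_norm_sq,
          div_mul_cancel₀ _ hv2.ne'] at h1
        linarith
      have hVo : IsOpen {y : Euc m | ⟪y, v⟫ < ⟪y₀, v⟫ + ‖v‖ ^ 2} :=
        isOpen_lt (by fun_prop) continuous_const
      have hVne : ({y : Euc m | ⟪y, v⟫ < ⟪y₀, v⟫ + ‖v‖ ^ 2} ∩ U).Nonempty :=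
        mem_closure_iff.1 (hUΩ ▸ hy₀) _ hVo (lt_add_of_pos_right _ hv2)
      refine ((hVo.inter hUo).measure_pos volume hVne).trans_le (measure_mono ?_)
      rintro y ⟨hy1, hyU⟩
      have hyB : y ∈ Ω \ R ⁻¹' Ω := by
        refine ⟨hUΩ ▸ subset_closure hyU, fun hRy => ?_⟩
        have h1 := hsup _ hRy
        rw [hRinner] at h1
        have h2 : ⟪y, v⟫ < ⟪y₀, v⟫ + ‖v‖ ^ 2 := hy1
        linarith
      exact ⟨(hlt y hyB).ne', hyB⟩
    · exact (ae_restrict_iff' (hΩm.diff hRm)).2 (Eventually.of_forall fun y hy => (hlt y hy).le)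
    · exact (hint (hkc.sub hkRc)).mono_set sdiff_subset
  have e1 : pot κ Ω (p + v) = ∫ y in Ω, k (R y) := by
    simp only [pot, hdist, hk]
  have e2 : pot κ Ω p = ∫ y in Ω, k y := rfl
  rw [e1, e2, ← integral_inter_add_sdiff hRm (hint hkc), ← integral_inter_add_sdiff hRm (hint hkRc),
    hA, add_lt_add_iff_left, ← sub_pos, ← integral_sub]
  · exact hpos
  · exact (hint hkc).mono_set sdiff_subset
  · exact (hint hkRc).mono_set sdiff_subset

/-- The point of `ℝ^(n+1)` with first coordinate `t` and remaining coordinates `z`. -/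
def consPt {n : ℕ} (t : ℝ) (z : Euc n) : Euc (n + 1) :=
  WithLp.toLp 2 (Fin.cons t z.ofLp)

@[simp] lemma consPt_zero {n : ℕ} (t : ℝ) (z : Euc n) : consPt t z 0 = t := rfl

@[simp] lemma consPt_succ {n : ℕ} (t : ℝ) (z : Euc n) (i : Fin n) : consPt t z i.succ = z i := rfl

lemma exists_eq_consPt {n : ℕ} (y : Euc (n + 1)) : ∃ t z, y = consPt t z :=
  ⟨y 0, WithLp.toLp 2 (Fin.tail y.ofLp), by ext i; cases i using Fin.cases <;> rfl⟩

lemma inner_consPt {n : ℕ} (s t : ℝ) (x z : Euc n) :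
    ⟪consPt s x, consPt t z⟫ = s * t + ⟪x, z⟫ := by
  simp [PiLp.inner_apply, Fin.sum_univ_succ, mul_comm]

lemma norm_consPt_sq {n : ℕ} (t : ℝ) (z : Euc n) : ‖consPt t z‖ ^ 2 = t ^ 2 + ‖z‖ ^ 2 := by
  rw [← real_inner_self_eq_norm_sq, inner_consPt, real_inner_self_eq_norm_sq, sq t]

lemma norm_consPt_zero {n : ℕ} (z : Euc n) : ‖consPt 0 z‖ = ‖z‖ := by
  rw [← sq_eq_sq₀ (norm_nonneg _) (norm_nonneg _), norm_consPt_sq]; simp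

lemma consPt_add_smul {n : ℕ} (s t c : ℝ) (x z : Euc n) :
    consPt s x + c • consPt t z = consPt (s + c * t) (x + c • z) := by
  ext i; cases i using Fin.cases <;> simp

lemma dist_consPt_sq {n : ℕ} (s t : ℝ) (x z : Euc n) :
    dist (consPt s x) (consPt t z) ^ 2 = (s - t) ^ 2 + dist x z ^ 2 := by
  have : consPt s x - consPt t z = consPt (s - t) (x - z) := by
    ext i; cases i using Fin.cases <;> simp
  rw [dist_eq_norm, dist_eq_norm, this, norm_consPt_sq]

lemma continuous_consPt {n : ℕ} : Continuous fun q : ℝ × Euc n => consPt q.1 q.2 := by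
  unfold consPt
  refine (PiLp.continuous_toLp 2 _).comp (continuous_pi fun i => ?_)
  cases i using Fin.cases <;> simp <;> fun_prop

/-- Cartesian decomposition of `ℝ^(n+1)` as a measurable equivalence. -/
def consEquiv (n : ℕ) : ℝ × Euc n ≃ᵐ Euc (n + 1) :=
  (((MeasurableEquiv.refl ℝ).prodCongr (MeasurableEquiv.toLp 2 (Fin n → ℝ)).symm).trans
    (MeasurableEquiv.piFinSuccAbove (fun _ => ℝ) 0).symm).trans
    (MeasurableEquiv.toLp 2 (Fin (n + 1) → ℝ))

lemma consEquiv_apply {n : ℕ} (q : ℝ × Euc n) : consEquiv n q = consPt q.1 q.2 := by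
  ext i; cases i using Fin.cases <;> rfl

lemma measurePreserving_consEquiv (n : ℕ) : MeasurePreserving (consEquiv n) := by
  have h1 := (MeasurePreserving.id (volume : Measure ℝ)).prod (PiLp.volume_preserving_ofLp (Fin n))
  have h2 := MeasurePreserving.symm _ (volume_preserving_piFinSuccAbove (fun _ : Fin (n + 1) => ℝ) 0)
  exact (PiLp.volume_preserving_toLp (Fin (n + 1))).comp (h2.comp h1)

/-- The body of revolution with profile `ω` over `[0, 1]`. -/
def revolutionBody (n : ℕ) (ω : ℝ → ℝ) : Set (Euc (n + 1)) :=
  {y | 0 ≤ y 0 ∧ y 0 ≤ 1 ∧ ‖y - y 0 • EuclideanSpace.single (0 : Fin (n + 1)) (1 : ℝ)‖ ≤ ω (y 0)}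

lemma consPt_mem_revolutionBody {n : ℕ} {ω : ℝ → ℝ} {t : ℝ} {z : Euc n} :
    consPt t z ∈ revolutionBody n ω ↔ t ∈ Icc (0 : ℝ) 1 ∧ ‖z‖ ≤ ω t := by
  have : consPt t z - t • EuclideanSpace.single (0 : Fin (n + 1)) (1 : ℝ) = consPt 0 z := by
    ext i; cases i using Fin.cases <;> simp
  simp only [revolutionBody, mem_ofPred_eq, consPt_zero, this, norm_consPt_zero, mem_Icc, and_assoc]

lemma integral_revolutionBody {n : ℕ} {ω : ℝ → ℝ} (hc : IsCompact (revolutionBody n ω))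
    {g : Euc (n + 1) → ℝ} (hg : Continuous g) :
    ∫ y in revolutionBody n ω, g y =
      ∫ t in (0 : ℝ)..1, ∫ z in closedBall (0 : Euc n) (ω t), g (consPt t z) := by
  have hm : MeasurableSet (revolutionBody n ω) := hc.isClosed.measurableSet
  have hint : Integrable ((revolutionBody n ω).indicator g) :=
    (integrable_indicator_iff hm).2 (hg.continuousOn.integrableOn_compact hc)
  rw [← integral_indicator hm, ← (measurePreserving_consEquiv n).integral_comp']
  have hint' : Integrable (fun q => (revolutionBody n ω).indicator g (consEquiv n q)) :=
    (measurePreserving_consEquiv n).integrable_comp_of_integrable hint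
  rw [Measure.volume_eq_prod, integral_prod _ hint',
    intervalIntegral.integral_of_le zero_le_one, ← integral_Icc_eq_integral_Ioc,
    ← integral_indicator measurableSet_Icc]
  congr 1 with t
  by_cases ht : t ∈ Icc (0 : ℝ) 1
  · rw [indicator_of_mem ht, ← integral_indicator measurableSet_closedBall]
    congr 1 with z
    rw [consEquiv_apply]
    by_cases hz : ‖z‖ ≤ ω t
    · rw [indicator_of_mem (consPt_mem_revolutionBody.2 ⟨ht, hz⟩), indicator_of_mem (by simpa)]
    · rw [indicator_of_notMem fun h => hz (consPt_mem_revolutionBody.1 h).2,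
        indicator_of_notMem (by simpa using hz)]
  · rw [indicator_of_notMem ht, ← integral_zero (Euc n) ℝ]
    congr 1 with z
    rw [consEquiv_apply, indicator_of_notMem fun h => ht (consPt_mem_revolutionBody.1 h).1]

lemma continuous_poissonKernel {h : ℝ} (hh : 0 < h) (p : ℝ) :
    Continuous fun r : ℝ => h / (r ^ 2 + h ^ 2) ^ p := by
  refine continuous_const.div (Continuous.rpow_const (by fun_prop) fun r => Or.inl ?_) fun r => ?_
    <;> positivity

lemma apot_consPt_zero {n : ℕ} (hn : n ≠ 0) {ω : ℝ → ℝ} (hc : IsCompact (revolutionBody n ω))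
    (hω : ∀ t ∈ Icc (0 : ℝ) 1, 0 ≤ ω t) {h : ℝ} (hh : 0 < h) (s : ℝ) :
    apot (n + 1) (revolutionBody n ω) (consPt s 0) h =
      h * volume.real (ball (0 : Euc n) 1) *
        ∫ t in (0 : ℝ)..1, sliceKer n √((s - t) ^ 2 + h ^ 2) (ω t) := by
  unfold apot
  rw [integral_revolutionBody (g := fun y => h / (dist (consPt s 0) y ^ 2 + h ^ 2) ^
    ((((n + 1 : ℕ) : ℝ) + 1) / 2)) hc ((continuous_poissonKernel hh _).comp (by fun_prop)),
    ← intervalIntegral.integral_const_mul]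
  refine intervalIntegral.integral_congr fun t ht => ?_
  rw [uIcc_of_le zero_le_one] at ht
  rw [mul_assoc, ← integral_closedBall_eq_sliceKer hn (by positivity) (hω t ht),
    ← integral_const_mul]
  congr 1 with z
  rw [dist_consPt_sq, dist_zero_left, Real.sq_sqrt (by positivity), div_eq_mul_inv]
  congr 3
  · ring
  · push_cast; ring

lemma apot_consPt_lt {n : ℕ} {ω : ℝ → ℝ} (hbody : IsBody (revolutionBody n ω)) {h : ℝ}
    (hh : 0 < h) (s : ℝ) {x : Euc n} (hx : x ≠ 0) :
    apot (n + 1) (revolutionBody n ω) (consPt s x) h <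
      apot (n + 1) (revolutionBody n ω) (consPt s 0) h := by
  have hadd : consPt s x = consPt s 0 + consPt 0 x := by
    simpa using (consPt_add_smul s 0 1 0 x).symm
  have hx2 : ‖x‖ ^ 2 ≠ 0 := by positivity
  have hsq : ∀ c (z : Euc n), ‖z + c • x‖ ^ 2 = ‖z‖ ^ 2 + c * (2 * ⟪z, x⟫ + c * ‖x‖ ^ 2) := by
    intro c z
    rw [norm_add_sq_real, real_inner_smul_right, norm_smul, mul_pow, Real.norm_eq_abs, sq_abs]
    ring
  have hmem : ∀ {t c : ℝ} {z : Euc n}, consPt t z ∈ revolutionBody n ω →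
      c * (2 * ⟪z, x⟫ + c * ‖x‖ ^ 2) ≤ 0 →
      consPt t z + c • consPt 0 x ∈ revolutionBody n ω := by
    intro t c z hz hc
    rw [consPt_add_smul, mul_zero, add_zero]
    rw [consPt_mem_revolutionBody] at hz ⊢
    refine ⟨hz.1, le_trans ?_ hz.2⟩
    rw [← sq_le_sq₀ (norm_nonneg _) (norm_nonneg _), hsq]
    linarith
  rw [hadd]
  refine pot_add_lt_pot (κ := fun r => h / (r ^ 2 + h ^ 2) ^ ((((n + 1 : ℕ) : ℝ) + 1) / 2))
    (continuous_poissonKernel hh _) ?_ hbody ?_ ?_ ?_ ?_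
  · intro a ha b hb hab
    have ha' : 0 ≤ a := ha
    dsimp only
    gcongr
  · rw [← norm_ne_zero_iff, norm_consPt_zero]
    exact norm_ne_zero_iff.2 hx
  · simp [inner_consPt]
  · intro y hy
    obtain ⟨t, z, rfl⟩ := exists_eq_consPt y
    rw [sub_eq_add_neg, ← neg_smul]
    refine hmem hy (le_of_eq ?_)
    rw [inner_consPt, norm_consPt_zero]
    field_simp
    ring
  · intro y hy
    obtain ⟨t, z, rfl⟩ := exists_eq_consPt y
    rw [inner_consPt, norm_consPt_zero]
    intro hle
    refine hmem hy ?_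
    have : 2 * ⟪z, x⟫ + (1 - 2 * (t * 0 + ⟪z, x⟫) / ‖x‖ ^ 2) * ‖x‖ ^ 2 = ‖x‖ ^ 2 := by
      field_simp; ring
    rw [this]
    exact mul_nonpos_of_nonpos_of_nonneg hle (by positivity)

lemma exists_pos_of_isBody_revolutionBody {n : ℕ} (hn : n ≠ 0) {ω : ℝ → ℝ}
    (hbody : IsBody (revolutionBody n ω)) : ∃ t ∈ Icc (0 : ℝ) 1, 0 < ω t := by
  obtain ⟨U, hUo, ⟨y, hy⟩, -, hU⟩ := hbody
  by_contra! hcon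
  have hzero : ∀ {t : ℝ} {z : Euc n}, consPt t z ∈ U → z = 0 := by
    intro t z hz
    have h1 : consPt t z ∈ revolutionBody n ω := hU ▸ subset_closure hz
    rw [consPt_mem_revolutionBody] at h1
    exact norm_le_zero_iff.1 (h1.2.trans (hcon t h1.1))
  obtain ⟨t, z, rfl⟩ := exists_eq_consPt y
  obtain rfl := hzero hy
  set e : Euc n := EuclideanSpace.single ⟨0, Nat.pos_of_ne_zero hn⟩ 1 with he
  have he0 : e ≠ 0 := by simp [he]
  have hc : Continuous fun c : ℝ => consPt t (c • e) :=
    continuous_consPt.comp (by fun_prop : Continuous fun c : ℝ => (t, c • e))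
  have hev : ∀ᶠ c in 𝓝[≠] (0 : ℝ), consPt t (c • e) ∈ U :=
    (hc.continuousAt.eventually_mem (hUo.mem_nhds (by simpa using hy))).filter_mono
      nhdsWithin_le_nhds
  obtain ⟨c, hcU, hc0⟩ := (hev.and self_mem_nhdsWithin).exists
  exact hc0 (by simpa [he0] using hzero hcU)

lemma concaveOn_midpoint_of_pow {n : ℕ} (hn : n ≠ 0) {ω : ℝ → ℝ}
    (hω : ∀ t ∈ Icc (0 : ℝ) 1, 0 ≤ ω t)
    (hconc : ConcaveOn ℝ (Icc (0 : ℝ) 1) fun t => ω t ^ n) {t r : ℝ} (ht : t ∈ Icc (0 : ℝ) 1)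
    (hr : r ∈ Icc (0 : ℝ) 1) : (ω t + ω r) / 2 ≤ ω ((t + r) / 2) := by
  have hz : (t + r) / 2 ∈ Icc (0 : ℝ) 1 := ⟨by linarith [ht.1, hr.1], by linarith [ht.2, hr.2]⟩
  refine le_of_pow_le_pow_left₀ hn (hω _ hz) ?_
  have h1 := hconc.2 ht hr (show (0 : ℝ) ≤ 1 / 2 by norm_num)
    (show (0 : ℝ) ≤ 1 / 2 by norm_num) (by norm_num)
  have h2 := (convexOn_pow n).2 (hω t ht) (hω r hr) (show (0 : ℝ) ≤ 1 / 2 by norm_num)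
    (show (0 : ℝ) ≤ 1 / 2 by norm_num) (by norm_num)
  simp only [smul_eq_mul] at h1 h2
  rw [show (1 / 2 : ℝ) * t + 1 / 2 * r = (t + r) / 2 by ring] at h1
  rw [show (1 / 2 : ℝ) * ω t + 1 / 2 * ω r = (ω t + ω r) / 2 by ring] at h2
  exact h2.trans h1

lemma pos_of_concaveOn_of_exists_pos {f : ℝ → ℝ} (hf : ∀ t ∈ Icc (0 : ℝ) 1, 0 ≤ f t)
    (hconc : ConcaveOn ℝ (Icc (0 : ℝ) 1) f) (hpos : ∃ t ∈ Icc (0 : ℝ) 1, 0 < f t) :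
    ∀ t ∈ Ioo (0 : ℝ) 1, 0 < f t := by
  obtain ⟨r, hr, hfr⟩ := hpos
  intro t ht
  have h0 : (0 : ℝ) ∈ Icc (0 : ℝ) 1 := by simp
  have h1 : (1 : ℝ) ∈ Icc (0 : ℝ) 1 := by simp
  rcases lt_trichotomy t r with h | rfl | h
  · have hr0 : 0 < r := ht.1.trans h
    have ha : 0 ≤ 1 - t / r := by rw [sub_nonneg, div_le_one hr0]; exact h.le
    have := hconc.2 h0 hr ha (div_nonneg ht.1.le hr0.le) (by ring)
    simp only [smul_eq_mul, mul_zero, zero_add, div_mul_cancel₀ _ hr0.ne'] at this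
    refine lt_of_lt_of_le ?_ this
    have h2 : 0 < t / r * f r := mul_pos (div_pos ht.1 hr0) hfr
    have h3 : 0 ≤ (1 - t / r) * f 0 := mul_nonneg ha (hf 0 h0)
    linarith
  · exact hfr
  · have hr1 : 0 < 1 - r := by linarith [ht.2]
    have ha : 0 < (1 - t) / (1 - r) := div_pos (by linarith [ht.2]) hr1
    have hb : 0 ≤ (t - r) / (1 - r) := div_nonneg (by linarith) hr1.le
    have := hconc.2 hr h1 ha.le hb (by field_simp; ring)
    simp only [smul_eq_mul] at this
    rw [show (1 - t) / (1 - r) * r + (t - r) / (1 - r) * 1 = t by field_simp; ring] at this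
    have h2 : 0 < (1 - t) / (1 - r) * f r := mul_pos ha hfr
    have h3 : 0 ≤ (t - r) / (1 - r) * f 1 := mul_nonneg hb (hf 1 h1)
    linarith

/-- uniqueness of an illuminating center of a suitable body of revolution for
every height `h > 0`. -/
theorem unique_illuminating_center_revolution (m : ℕ) (hm : 2 ≤ m) (ω : ℝ → ℝ)
    (hcont : ContinuousOn ω (Icc (0:ℝ) 1))
    (hnonneg : ∀ t ∈ Icc (0:ℝ) 1, 0 ≤ ω t)
    (hpw : ∃ n : ℕ, ∃ t : Fin (n + 1) → ℝ, StrictMono t ∧ t 0 = 0 ∧ t (Fin.last n) = 1 ∧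
      ∀ i : Fin n, ContDiffOn ℝ 1 ω (Icc (t i.castSucc) (t i.succ)))
    (hconc : ConcaveOn ℝ (Icc (0:ℝ) 1) fun t => ω t ^ (m - 1))
    (Ω : Set (Euc m))
    (hΩ : Ω = {y : Euc m | 0 ≤ y ⟨0, by omega⟩ ∧ y ⟨0, by omega⟩ ≤ 1 ∧
      ‖y - y ⟨0, by omega⟩ • EuclideanSpace.single (⟨0, by omega⟩ : Fin m) (1 : ℝ)‖ ≤
        ω (y ⟨0, by omega⟩)})
    (hbody : IsBody Ω)
    (h : ℝ) (hh : 0 < h) :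
    ∃! x : Euc m, ∀ y : Euc m, apot m Ω y h ≤ apot m Ω x h := by
  obtain ⟨n, rfl⟩ : ∃ n, m = n + 1 := ⟨m - 1, by omega⟩
  have hn : n ≠ 0 := by omega
  rw [Nat.add_sub_cancel] at hconc
  obtain rfl : Ω = revolutionBody n ω := hΩ
  have hc : IsCompact (revolutionBody n ω) := by
    obtain ⟨U, -, -, hUb, hU⟩ := hbody
    rw [hU]
    exact hUb.isCompact_closure
  have hpos : ∀ t ∈ Ioo (0 : ℝ) 1, 0 < ω t := by
    obtain ⟨r, hr, hωr⟩ := exists_pos_of_isBody_revolutionBody hn hbody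
    intro t ht
    have h1 := pos_of_concaveOn_of_exists_pos (fun t ht => pow_nonneg (hnonneg t ht) n) hconc
      ⟨r, hr, pow_pos hωr n⟩ t ht
    refine lt_of_le_of_ne (hnonneg t (Ioo_subset_Icc_self ht)) fun h0 => ?_
    simp [← h0, hn] at h1
  set w : ℝ → ℝ := IccExtend (zero_le_one' ℝ) ((Icc (0 : ℝ) 1).domRestrict ω) with hw
  have hwω : ∀ t ∈ Icc (0 : ℝ) 1, w t = ω t := fun t ht => by
    rw [hw, IccExtend_of_mem _ _ ht, domRestrict_apply]
  have hwc : Continuous w := (continuousOn_iff_continuous_domRestrict.1 hcont).Icc_extend'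
  have hmid : ∀ t ∈ Icc (0 : ℝ) 1, ∀ r ∈ Icc (0 : ℝ) 1, (w t + w r) / 2 ≤ w ((t + r) / 2) := by
    intro t ht r hr
    rw [hwω t ht, hwω r hr, hwω _ ⟨by linarith [ht.1, hr.1], by linarith [ht.2, hr.2]⟩]
    exact concaveOn_midpoint_of_pow hn hnonneg hconc ht hr
  obtain ⟨s, hs, hsu⟩ := existsUnique_isMax_integral_sliceKer n hwc
    (fun t ht => by rw [hwω t (Ioo_subset_Icc_self ht)]; exact hpos t ht)
    (fun t ht => by rw [hwω t ht]; exact hnonneg t ht) hmid hh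
  have hC : 0 < h * volume.real (ball (0 : Euc n) 1) :=
    mul_pos hh (ENNReal.toReal_pos (measure_ball_pos volume _ one_pos).ne' measure_ball_lt_top.ne)
  have haxis : ∀ r, apot (n + 1) (revolutionBody n ω) (consPt r 0) h =
      h * volume.real (ball (0 : Euc n) 1) *
        ∫ t in (0 : ℝ)..1, sliceKer n √((r - t) ^ 2 + h ^ 2) (w t) := by
    intro r
    rw [apot_consPt_zero hn hc hnonneg hh r]
    congr 1
    refine intervalIntegral.integral_congr fun t ht => ?_
    rw [uIcc_of_le zero_le_one] at ht
    simp only [hwω t ht]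
  refine ⟨consPt s 0, fun y => ?_, fun y hy => ?_⟩
  · obtain ⟨r, z, rfl⟩ := exists_eq_consPt y
    have h1 : apot (n + 1) (revolutionBody n ω) (consPt r 0) h ≤
        apot (n + 1) (revolutionBody n ω) (consPt s 0) h := by
      rw [haxis, haxis]
      exact mul_le_mul_of_nonneg_left (hs r) hC.le
    by_cases hz : z = 0
    · rwa [hz]
    · exact (apot_consPt_lt hbody hh r hz).le.trans h1
  · obtain ⟨r, z, rfl⟩ := exists_eq_consPt y
    obtain rfl : z = 0 := by
      by_contra hz
      exact (apot_consPt_lt hbody hh r hz).not_ge (hy _)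
    rw [hsu r fun s' => ?_]
    have h1 := hy (consPt s' 0)
    rw [haxis, haxis] at h1
    exact le_of_mul_le_mul_left h1 hC
end
end
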